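/- Let λ = Σ_{i=1}^{n+1} λ_i ω_i be a dominant integral weight of sl(n+2) and V(λ)_Φ the restriction of V(λ) to sl(n+1) ⋉ C^{n+1} via Φ. Then the nilpotency profile of the φ-operators on the generating highest weight vector is constant: J_1^{λ_0} = λ_1 + 1 and J_k^{λ_0}(i_1,...,i_{k−1}) = λ_k + 1 for all 2 ≤ k ≤ n+1 and all admissible 0 ≤ i_h ≤ λ_h. Consequently V(λ)_Φ decomposes as an sl(n+1)-module as ⊕_{0 ≤ k_l ≤ λ_l} V(λ_0 + Σ_{l=1}^{n}(k_l − k_{l+1}) ω_l). -/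

import Mathlib

open Module

namespace Paper

/-- The pairing `(α_i, α_{p,q})` (value of the root `α_{p,q} = α_p + ⋯ + α_q`
on the coroot `H_i`) for `sl`, in the paper's normalization. -/
def pair (i p q : ℕ) : ℤ :=
  (if i = p then 1 else 0) + (if i = q then 1 else 0)
    - (if i + 1 = p then 1 else 0) - (if i = q + 1 then 1 else 0)

/-- A module over `sl(N+1, ℂ)`, described through the action of the Chevalley-type
generators `H_i` (`1 ≤ i ≤ N`), `E_{p,q}`, `F_{p,q}` (`1 ≤ p ≤ q ≤ N`), subject to the
structure relations (2.7) of the paper.  Indices outside the valid ranges are junk. -/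
structure SLRep (N : ℕ) (M : Type) [AddCommGroup M] [Module ℂ M] where
  H : ℕ → Module.End ℂ M
  E : ℕ → ℕ → Module.End ℂ M
  F : ℕ → ℕ → Module.End ℂ M
  hHH : ∀ i j, 1 ≤ i → i ≤ N → 1 ≤ j → j ≤ N → ⁅H i, H j⁆ = 0
  hHE : ∀ i p q, 1 ≤ i → i ≤ N → 1 ≤ p → p ≤ q → q ≤ N →
    ⁅H i, E p q⁆ = ((pair i p q : ℤ) : ℂ) • E p q
  hHF : ∀ i p q, 1 ≤ i → i ≤ N → 1 ≤ p → p ≤ q → q ≤ N →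
    ⁅H i, F p q⁆ = -(((pair i p q : ℤ) : ℂ)) • F p q
  hEE : ∀ p q r s, 1 ≤ p → p ≤ q → q ≤ N → 1 ≤ r → r ≤ s → s ≤ N →
    ⁅E p q, E r s⁆ = (if q + 1 = r then E p s else 0) - (if p = s + 1 then E r q else 0)
  hFF : ∀ p q r s, 1 ≤ p → p ≤ q → q ≤ N → 1 ≤ r → r ≤ s → s ≤ N →
    ⁅F p q, F r s⁆ = (if p = s + 1 then F r q else 0) - (if q + 1 = r then F p s else 0)
  hEF : ∀ p q r s, 1 ≤ p → p ≤ q → q ≤ N → 1 ≤ r → r ≤ s → s ≤ N →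
    ⁅E p q, F r s⁆ =
      (if p = r ∧ q = s then ∑ t ∈ Finset.Icc p q, H t else 0)
      + (if p = r ∧ q < s then -F (q + 1) s else 0)
      + (if p = r ∧ s < q then -E (s + 1) q else 0)
      + (if q = s ∧ p < r then E p (r - 1) else 0)
      + (if q = s ∧ r < p then F r (p - 1) else 0)

/-- A module over the perfect Lie algebra `sl(n+1) ⋉ ℂ^{n+1}`:
an `sl(n+1)`-module together with the action of the radical generators
`P_j` (`1 ≤ j ≤ n+1`), subject to the remaining relations of (2.7). -/
structure SLPRep (n : ℕ) (M : Type) [AddCommGroup M] [Module ℂ M] extends SLRep n M where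
  P : ℕ → Module.End ℂ M
  hHP : ∀ i j, 1 ≤ i → i ≤ n → 1 ≤ j → j ≤ n + 1 →
    ⁅H i, P j⁆ = (((if i = j then 1 else 0) - (if i + 1 = j then 1 else 0) : ℤ) : ℂ) • P j
  hEP : ∀ p q j, 1 ≤ p → p ≤ q → q ≤ n → 1 ≤ j → j ≤ n + 1 →
    ⁅E p q, P j⁆ = if q + 1 = j then P p else 0
  hFP : ∀ p q j, 1 ≤ p → p ≤ q → q ≤ n → 1 ≤ j → j ≤ n + 1 →
    ⁅F p q, P j⁆ = if p = j then P (q + 1) else 0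
  hPP : ∀ i j, 1 ≤ i → i ≤ n + 1 → 1 ≤ j → j ≤ n + 1 → ⁅P i, P j⁆ = 0

/-- `μ_{k,s} = -((μ_k + 1) + ⋯ + (μ_s + 1))` (Definition 3.4). -/
def mus (μ : ℕ → ℤ) (k s : ℕ) : ℤ := -(∑ i ∈ Finset.Icc k s, (μ i + 1))

section Alg

variable {A : Type} [Ring A] [Algebra ℂ A]

/-- `F^{(μ(s))}_{i,j} = (∏_{k=i+1}^{j} μ_{k,s}) F_{i,j}` (Definition 3.6). -/
def Fm (F : ℕ → ℕ → A) (μ : ℕ → ℤ) (s i j : ℕ) : A :=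
  (((∏ k ∈ Finset.Icc (i + 1) j, mus μ k s : ℤ)) : ℂ) • F i j

/-- `P^{(μ(s))}_{i} = (∏_{k=1}^{i-1} μ_{k,s-1}) P_i` (Definition 3.6). -/
def Pm (P : ℕ → A) (μ : ℕ → ℤ) (s i : ℕ) : A :=
  (((∏ k ∈ Finset.Icc 1 (i - 1), mus μ k (s - 1) : ℤ)) : ℂ) • P i

/-- The elements `Q^{(μ(s))}_k` of Definition 3.7, defined by the recursion
`Q^{(μ(s))}_{s+1} = 1`, `Q^{(μ(s))}_{s-k} = ∑_{l=0}^{k} Q^{(μ(s))}_{s-l+1} F^{(μ(s))}_{s-k,s-l}`. -/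
noncomputable def Qop (F : ℕ → ℕ → A) (μ : ℕ → ℤ) (s k : ℕ) : A :=
  if s + 1 ≤ k then 1
  else ∑ l ∈ (Finset.range (s + 1 - k)).attach,
      Qop F μ s (s - l.1 + 1) * Fm F μ s k (s - l.1)
termination_by s + 1 - k
decreasing_by
  have := l.2; simp only [Finset.mem_range] at this; omega

/-- The elements `R^{(μ(s))}_{i,k}` of Definition 3.8:
`R^{(μ(s))}_{i,0} = 1`, `R^{(μ(s))}_{i,k} = ∑_{l=0}^{k-1} F^{(μ(s))}_{i+l,i+k-1} R^{(μ(s))}_{i,l}`. -/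
noncomputable def Rop (F : ℕ → ℕ → A) (μ : ℕ → ℤ) (s i : ℕ) : ℕ → A
  | 0 => 1
  | k + 1 => ∑ l ∈ (Finset.range (k + 1)).attach,
      Fm F μ s (i + l.1) (i + k) * Rop F μ s i l.1
termination_by k => k
decreasing_by
  have := l.2; simp only [Finset.mem_range] at this; omega

end Alg

variable {M : Type} [AddCommGroup M] [Module ℂ M]

/-- The operator `φ_i` at weight `μ`:
`φ_i = P^{(μ(i))}_i + ∑_{k=1}^{i-1} Q^{(μ(i-1))}_k P^{(μ(i))}_k` (Theorem 3.12). -/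
noncomputable def PhiOp (F : ℕ → ℕ → Module.End ℂ M) (P : ℕ → Module.End ℂ M)
    (μ : ℕ → ℤ) (i : ℕ) : Module.End ℂ M :=
  Pm P μ i i + ∑ k ∈ Finset.Icc 1 (i - 1), Qop F μ (i - 1) k * Pm P μ i k

/-- The weight shift `μ ↦ μ + ω_i - ω_{i-1}` in fundamental-weight coordinates. -/
def wsh (i : ℕ) (μ : ℕ → ℤ) : ℕ → ℤ := fun l =>
  μ l + (if l = i then 1 else 0) - (if l + 1 = i then 1 else 0)

/-- `v` is a highest weight vector of weight `μ` for the `sl(N+1)`-action. -/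
def IsHWvec (N : ℕ) (Hop : ℕ → Module.End ℂ M) (Eop : ℕ → ℕ → Module.End ℂ M)
    (μ : ℕ → ℤ) (v : M) : Prop :=
  (∀ i, 1 ≤ i → i ≤ N → Hop i v = ((μ i : ℤ) : ℂ) • v) ∧
  (∀ p q, 1 ≤ p → p ≤ q → q ≤ N → Eop p q v = 0)

/-- Successively apply the operators `φ_i`, for `i` running through a list,
keeping track of the weight shifts. -/
noncomputable def phiList (F : ℕ → ℕ → Module.End ℂ M) (P : ℕ → Module.End ℂ M) :
    List ℕ → (ℕ → ℤ) → M → M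
  | [], _, v => v
  | i :: L, μ, v => phiList F P L (wsh i μ) (PhiOp F P μ i v)

/-- Turn a list of exponents `[k_1, …, k_r]` (starting label `j`) into the list
`j, …, j (k_1 times), j+1, …`; applying `phiList` along it computes
`φ_{j+r-1}^{k_r}(⋯(φ_j^{k_1}(v))⋯)`. -/
def expList : List ℕ → ℕ → List ℕ
  | [], _ => []
  | m :: iv, j => List.replicate m j ++ expList iv (j + 1)

/-- The list encoding `φ_{k-1}^{i_{k-1}}(⋯(φ_1^{i_1}(v))⋯)` for the exponents `i_1, …, i_{k-1}`. -/
def evec (k : ℕ) (iv : ℕ → ℕ) : List ℕ :=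
  (List.range (k - 1)).flatMap fun t => List.replicate (iv (t + 1)) (t + 1)

/-- A submodule is invariant under the `sl(N+1)`-action. -/
def slInvariant (N : ℕ) (Hop : ℕ → Module.End ℂ M) (Eop Fop : ℕ → ℕ → Module.End ℂ M)
    (Ns : Submodule ℂ M) : Prop :=
  (∀ i, 1 ≤ i → i ≤ N → ∀ v ∈ Ns, Hop i v ∈ Ns) ∧
  (∀ p q, 1 ≤ p → p ≤ q → q ≤ N → ∀ v ∈ Ns, Eop p q v ∈ Ns ∧ Fop p q v ∈ Ns)

/-- A submodule is invariant under the full `sl(n+1) ⋉ ℂ^{n+1}`-action. -/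
def gInvariant (n : ℕ) (Hop : ℕ → Module.End ℂ M) (Eop Fop : ℕ → ℕ → Module.End ℂ M)
    (Pop : ℕ → Module.End ℂ M) (Ns : Submodule ℂ M) : Prop :=
  slInvariant n Hop Eop Fop Ns ∧ ∀ j, 1 ≤ j → j ≤ n + 1 → ∀ v ∈ Ns, Pop j v ∈ Ns

/-- `U(sl(N+1))·v`: the smallest `sl(N+1)`-invariant subspace containing `v`. -/
def slGen (N : ℕ) (Hop : ℕ → Module.End ℂ M) (Eop Fop : ℕ → ℕ → Module.End ℂ M)
    (v : M) : Submodule ℂ M :=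
  sInf {Ns | slInvariant N Hop Eop Fop Ns ∧ v ∈ Ns}

/-- `U(sl(n+1) ⋉ ℂ^{n+1})·v`. -/
def gGen (n : ℕ) (Hop : ℕ → Module.End ℂ M) (Eop Fop : ℕ → ℕ → Module.End ℂ M)
    (Pop : ℕ → Module.End ℂ M) (v : M) : Submodule ℂ M :=
  sInf {Ns | gInvariant n Hop Eop Fop Pop Ns ∧ v ∈ Ns}

end Paper

namespace Paper

variable {M : Type} [AddCommGroup M] [Module ℂ M]

/-- `φ_k^{J}(φ_{k-1}^{i_{k-1}}(⋯(φ_1^{i_1}(v))⋯))`. -/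
noncomputable def vIterJ (F : ℕ → ℕ → Module.End ℂ M) (P : ℕ → Module.End ℂ M)
    (μ : ℕ → ℤ) (v : M) (k : ℕ) (iv : ℕ → ℕ) (J : ℕ) : M :=
  phiList F P (evec k iv ++ List.replicate J k) μ v

/-- `J` is the minimal positive integer with `φ_k^J(φ_{k-1}^{i_{k-1}}(⋯)) = 0`. -/
def Jmin (F : ℕ → ℕ → Module.End ℂ M) (P : ℕ → Module.End ℂ M)
    (μ : ℕ → ℤ) (v : M) (k : ℕ) (iv : ℕ → ℕ) (J : ℕ) : Prop :=
  0 < J ∧ vIterJ F P μ v k iv J = 0 ∧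
    ∀ J', 0 < J' → J' < J → vIterJ F P μ v k iv J' ≠ 0

variable (n : ℕ)

/-- Restriction of the `sl(n+2)`-action along `Φ`: `H_i ↦ H_{i+1}`. -/
def Hr (σ : SLRep (n + 1) M) : ℕ → Module.End ℂ M := fun i => σ.H (i + 1)

/-- `E_{p,q} ↦ E_{p+1,q+1}`. -/
def Er (σ : SLRep (n + 1) M) : ℕ → ℕ → Module.End ℂ M := fun p q => σ.E (p + 1) (q + 1)

/-- `F_{p,q} ↦ F_{p+1,q+1}`. -/
def Fr (σ : SLRep (n + 1) M) : ℕ → ℕ → Module.End ℂ M := fun p q => σ.F (p + 1) (q + 1)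

/-- `P_j ↦ F_{1,j}`. -/
def Pr (σ : SLRep (n + 1) M) : ℕ → Module.End ℂ M := fun j => σ.F 1 j

/-- The `sl(n+1)`-weight `λ_0` (`(λ_0)_l = λ_{l+1}`). -/
def lam0 (lam : ℕ → ℕ) : ℕ → ℤ := fun l => (lam (l + 1) : ℤ)

/-- Exponent tuples `(k_1, …, k_{n+1})` with `0 ≤ k_l ≤ λ_l`. -/
def expType (lam : ℕ → ℕ) : Type :=
  {k : Fin (n + 1) → ℕ // ∀ l : Fin (n + 1), k l ≤ lam (l.1 + 1)}

instance (lam : ℕ → ℕ) : DecidableEq (expType n lam) := fun a b =>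
  decidable_of_iff (a.1 = b.1) Subtype.ext_iff.symm

/-- The exponent tuple extended to `ℕ` (by `0` outside `1, …, n+1`). -/
def keFun (k : Fin (n + 1) → ℕ) : ℕ → ℤ := fun t =>
  if h : 1 ≤ t ∧ t ≤ n + 1 then (k ⟨t - 1, by omega⟩ : ℤ) else 0

/-- The weight `λ_0 + ∑_{l=1}^{n} (k_l - k_{l+1}) ω_l`. -/
def nuW (lam : ℕ → ℕ) (k : Fin (n + 1) → ℕ) : ℕ → ℤ := fun l =>
  lam0 lam l + keFun n k l - keFun n k (l + 1)

/-- The iterated vector `φ_{n+1}^{k_{n+1}}(⋯(φ_1^{k_1}(v))⋯)` in the restricted module. -/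
noncomputable def wVec (σ : SLRep (n + 1) M) (lam : ℕ → ℕ) (v : M)
    (k : Fin (n + 1) → ℕ) : M :=
  phiList (Fr n σ) (Pr n σ) (expList (List.ofFn k) 1) (lam0 lam) v

end Paper


namespace Paper
section PartA

variable {M : Type} [AddCommGroup M] [Module ℂ M]

theorem lie_app {A B C : Module.End ℂ M} (h : ⁅A, B⁆ = C) (x : M) : A (B x) = B (A x) + C x := by
  rw [← h, Ring.lie_def]; simp

theorem sum_Icc_shift {A : Type} [AddCommMonoid A] (f : ℕ → A) (p q : ℕ) :
    ∑ t ∈ Finset.Icc (p + 1) (q + 1), f t = ∑ t ∈ Finset.Icc p q, f (t + 1) := by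
  rw [← Finset.map_add_right_Icc p q 1, Finset.sum_map]; rfl

/-- restriction to the subalgebra -/
def res (n : ℕ) (σ : SLRep (n + 1) M) : SLRep n M where
  H := Hr n σ
  E := Er n σ
  F := Fr n σ
  hHH i j _ _ _ _ := σ.hHH _ _ (by omega) (by omega) (by omega) (by omega)
  hHE i p q _ _ _ _ _ := by
    have := σ.hHE (i+1) (p+1) (q+1) (by omega) (by omega) (by omega) (by omega) (by omega)
    simpa [Hr, Er, pair] using this
  hHF i p q _ _ _ _ _ := by
    have := σ.hHF (i+1) (p+1) (q+1) (by omega) (by omega) (by omega) (by omega) (by omega)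
    simpa [Hr, Fr, pair] using this
  hEE p q r s _ _ _ _ _ _ := by
    have := σ.hEE (p+1) (q+1) (r+1) (s+1) (by omega) (by omega) (by omega) (by omega) (by omega)
      (by omega)
    simpa [Er] using this
  hFF p q r s _ _ _ _ _ _ := by
    have := σ.hFF (p+1) (q+1) (r+1) (s+1) (by omega) (by omega) (by omega) (by omega) (by omega)
      (by omega)
    simpa [Fr] using this
  hEF p q r s _ _ _ _ _ _ := by
    have := σ.hEF (p+1) (q+1) (r+1) (s+1) (by omega) (by omega) (by omega) (by omega) (by omega)
      (by omega)
    rw [sum_Icc_shift] at this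
    have e1 : (if q = s ∧ p < r then Er n σ p (r-1) else 0) =
      (if q = s ∧ p < r then σ.E (p+1) r else 0) := by
      split_ifs with h
      · rw [Er]; congr 1; omega
      · rfl
    have e2 : (if q = s ∧ r < p then Fr n σ r (p-1) else 0) =
      (if q = s ∧ r < p then σ.F (r+1) p else 0) := by
      split_ifs with h
      · rw [Fr]; congr 1; omega
      · rfl
    rw [e1, e2]
    simpa [Er, Fr, Hr] using this

/-- the image of the lowering operators -/
def nM (N : ℕ) (F : ℕ → ℕ → Module.End ℂ M) : Submodule ℂ M :=
  Submodule.span ℂ {y | ∃ p q x, 1 ≤ p ∧ p ≤ q ∧ q ≤ N ∧ y = F p q x}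

theorem mem_nM {N : ℕ} {F : ℕ → ℕ → Module.End ℂ M} {p q : ℕ} (h1 : 1 ≤ p) (h2 : p ≤ q)
    (h3 : q ≤ N) (x : M) : F p q x ∈ nM N F :=
  Submodule.subset_span ⟨p, q, x, h1, h2, h3, rfl⟩

theorem slGen_inv (N : ℕ) (H : ℕ → Module.End ℂ M) (E F : ℕ → ℕ → Module.End ℂ M) (w : M) :
    slInvariant N H E F (slGen N H E F w) := by
  constructor
  · intro i h1 h2 x hx
    rw [slGen, Submodule.mem_sInf] at *
    intro S hS
    exact hS.1.1 i h1 h2 x (hx S hS)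
  · intro p q h1 h2 h3 x hx
    rw [slGen, Submodule.mem_sInf, Submodule.mem_sInf] 
    rw [slGen, Submodule.mem_sInf] at hx
    exact ⟨fun S hS => (hS.1.2 p q h1 h2 h3 x (hx S hS)).1,
      fun S hS => (hS.1.2 p q h1 h2 h3 x (hx S hS)).2⟩

theorem slGen_self (N : ℕ) (H : ℕ → Module.End ℂ M) (E F : ℕ → ℕ → Module.End ℂ M) (w : M) :
    w ∈ slGen N H E F w := by
  rw [slGen, Submodule.mem_sInf]; exact fun S hS => hS.2

theorem slGen_min {N : ℕ} {H : ℕ → Module.End ℂ M} {E F : ℕ → ℕ → Module.End ℂ M} {w : M}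
    {S : Submodule ℂ M} (h : slInvariant N H E F S) (hw : w ∈ S) : slGen N H E F w ≤ S :=
  sInf_le ⟨h, hw⟩

theorem slGen_le {N : ℕ} (ρ : SLRep N M) {μ : ℕ → ℤ} {w : M} (hw : IsHWvec N ρ.H ρ.E μ w)
    (S : Submodule ℂ M) (hS : ∀ p q, 1 ≤ p → p ≤ q → q ≤ N → ∀ x ∈ S, ρ.F p q x ∈ S)
    (hwS : w ∈ S) : slGen N ρ.H ρ.E ρ.F w ≤ S := by
  set A : Submodule ℂ M := sInf {S | (∀ p q, 1 ≤ p → p ≤ q → q ≤ N → ∀ x ∈ S, ρ.F p q x ∈ S) ∧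
    w ∈ S} with hA
  have hAw : w ∈ A := by
    rw [hA, Submodule.mem_sInf]; exact fun S hS => hS.2
  have hAF : ∀ p q, 1 ≤ p → p ≤ q → q ≤ N → ∀ x ∈ A, ρ.F p q x ∈ A := by
    intro p q h1 h2 h3 x hx
    rw [hA, Submodule.mem_sInf] at *
    exact fun S hS => hS.1 p q h1 h2 h3 x (hx S hS)
  have hmin : ∀ S : Submodule ℂ M, (∀ p q, 1 ≤ p → p ≤ q → q ≤ N → ∀ x ∈ S, ρ.F p q x ∈ S) →
    w ∈ S → A ≤ S := fun S h1 h2 => sInf_le ⟨h1, h2⟩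
  have hAH : ∀ i, 1 ≤ i → i ≤ N → ∀ x ∈ A, ρ.H i x ∈ A := by
    intro i h1 h2
    have : A ≤ A ⊓ A.comap (ρ.H i) := by
      apply hmin
      · intro p q h3 h4 h5 x hx
        refine Submodule.mem_inf.2 ⟨hAF p q h3 h4 h5 x hx.1, ?_⟩
        rw [Submodule.mem_comap, lie_app (ρ.hHF i p q h1 h2 h3 h4 h5)]
        exact A.add_mem (hAF p q h3 h4 h5 _ hx.2) (by
          rw [LinearMap.smul_apply]
          exact A.smul_mem _ (hAF p q h3 h4 h5 x hx.1))
      · refine Submodule.mem_inf.2 ⟨hAw, ?_⟩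
        rw [Submodule.mem_comap, hw.1 i h1 h2]; exact A.smul_mem _ hAw
    exact fun x hx => (this hx).2
  have hAE : A ≤ A ⊓ ⨅ pq : {z : ℕ × ℕ // 1 ≤ z.1 ∧ z.1 ≤ z.2 ∧ z.2 ≤ N},
      A.comap (ρ.E pq.1.1 pq.1.2) := by
    apply hmin
    · intro r s h3 h4 h5 x hx
      refine Submodule.mem_inf.2 ⟨hAF r s h3 h4 h5 x hx.1, ?_⟩
      have hxE : ∀ p q, 1 ≤ p → p ≤ q → q ≤ N → ρ.E p q x ∈ A := by
        intro p q a b c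
        have := (Submodule.mem_iInf _).1 hx.2 ⟨(p,q), a, b, c⟩
        exact this
      rw [Submodule.mem_iInf]
      rintro ⟨⟨p, q⟩, a, b, c⟩
      simp only at a b c
      rw [Submodule.mem_comap, lie_app (ρ.hEF p q r s a b c h3 h4 h5)]
      refine A.add_mem (hAF r s h3 h4 h5 _ (hxE p q a b c)) ?_
      simp only [LinearMap.add_apply]
      refine A.add_mem (A.add_mem (A.add_mem (A.add_mem ?_ ?_) ?_) ?_) ?_
      · split_ifs with h
        · rw [LinearMap.sum_apply]
          refine A.sum_mem fun t ht => ?_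
          rw [Finset.mem_Icc] at ht
          exact hAH t (by omega) (by omega) x hx.1
        · simp
      · split_ifs with h
        · rw [LinearMap.neg_apply]
          exact A.neg_mem (hAF _ _ (by omega) (by omega) (by omega) x hx.1)
        · simp
      · split_ifs with h
        · rw [LinearMap.neg_apply]
          exact A.neg_mem (hxE _ _ (by omega) (by omega) (by omega))
        · simp
      · split_ifs with h
        · exact hxE _ _ (by omega) (by omega) (by omega)
        · simp
      · split_ifs with h
        · exact (hAF _ _ (by omega) (by omega) (by omega) x hx.1)
        · simp
    · refine Submodule.mem_inf.2 ⟨hAw, ?_⟩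
      rw [Submodule.mem_iInf]
      rintro ⟨⟨p, q⟩, a, b, c⟩
      rw [Submodule.mem_comap, hw.2 p q a b c]; exact A.zero_mem
  refine le_trans (slGen_min ⟨hAH, fun p q h1 h2 h3 x hx => ⟨?_, hAF p q h1 h2 h3 x hx⟩⟩ hAw)
    (hmin S hS hwS)
  exact (Submodule.mem_iInf _).1 (hAE hx).2 ⟨(p,q), h1, h2, h3⟩

theorem slGen_le_nM {N : ℕ} (ρ : SLRep N M) {μ : ℕ → ℤ} {w : M} (hw : IsHWvec N ρ.H ρ.E μ w) :
    slGen N ρ.H ρ.E ρ.F w ≤ Submodule.span ℂ {w} ⊔ nM N ρ.F := by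
  apply slGen_le ρ hw
  · intro p q h1 h2 h3 x _
    exact Submodule.mem_sup_right (mem_nM h1 h2 h3 x)
  · exact Submodule.mem_sup_left (Submodule.mem_span_singleton_self w)

/-- killed by simple raising operators implies killed by all -/
theorem E_of_simple {N : ℕ} (ρ : SLRep N M) {x : M}
    (h : ∀ m, 1 ≤ m → m ≤ N → ρ.E m m x = 0) :
    ∀ p q, 1 ≤ p → p ≤ q → q ≤ N → ρ.E p q x = 0 := by
  intro p q h1 h2 h3
  induction q, h2 using Nat.le_induction with
  | base => exact h p h1 h3
  | succ q hq ih =>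
    have := lie_app (ρ.hEE p q (q+1) (q+1) h1 hq (by omega) (by omega) le_rfl h3) x
    rw [h (q+1) (by omega) h3, ih (by omega)] at this
    simp only [map_zero, if_true] at this
    rw [if_neg (by omega)] at this
    simpa using this.symm

end PartA
end Paper


namespace Paper
section PartB

variable {M : Type} [AddCommGroup M] [Module ℂ M]

/-- coefficient -/
def bco (μ : ℕ → ℤ) (s k j : ℕ) : ℂ := ((∏ m ∈ Finset.Icc (k + 1) j, mus μ m s : ℤ) : ℂ)

theorem Icc_ins {m s : ℕ} (h : m ≤ s) : Finset.Icc m s = insert m (Finset.Icc (m + 1) s) := by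
  ext t; simp only [Finset.mem_Icc, Finset.mem_insert]; omega

theorem mus_rec (μ : ℕ → ℤ) {m s : ℕ} (h : m ≤ s) :
    mus μ m s = mus μ (m + 1) s - (μ m + 1) := by
  rw [mus, mus, Icc_ins h, Finset.sum_insert (by simp)]; ring

theorem bco_succ (μ : ℕ → ℤ) (s : ℕ) {k j : ℕ} (h : k ≤ j) :
    bco μ s k (j + 1) = bco μ s k j * ((mus μ (j + 1) s : ℤ) : ℂ) := by
  unfold bco
  rw [Finset.prod_Icc_succ_top (by omega)]; push_cast; rfl

theorem bco_left (μ : ℕ → ℤ) (s : ℕ) {k j : ℕ} (h : k + 1 ≤ j) :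
    bco μ s k j = ((mus μ (k + 1) s : ℤ) : ℂ) * bco μ s (k + 1) j := by
  unfold bco
  rw [Icc_ins h, Finset.prod_insert (by simp)]; push_cast; rfl

theorem bco_self (μ : ℕ → ℤ) (s k : ℕ) : bco μ s k k = 1 := by
  unfold bco; simp

theorem Qop_top {A : Type} [Ring A] [Algebra ℂ A] (F : ℕ → ℕ → A) (μ : ℕ → ℤ) (s : ℕ) :
    Qop F μ s (s + 1) = 1 := by
  rw [Qop, if_pos le_rfl]

theorem Qop_rec {A : Type} [Ring A] [Algebra ℂ A] (F : ℕ → ℕ → A) (μ : ℕ → ℤ) {s k : ℕ}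
    (h : k ≤ s) :
    Qop F μ s k = ∑ j ∈ Finset.Icc k s, Qop F μ s (j + 1) * Fm F μ s k j := by
  rw [Qop, if_neg (by omega),
    Finset.sum_attach (Finset.range (s + 1 - k)) (fun l => Qop F μ s (s - l + 1) * Fm F μ s k (s - l))]
  apply Finset.sum_nbij' (fun l => s - l) (fun j => s - j)
  all_goals (intro a ha; simp only [Finset.mem_range, Finset.mem_Icc] at *)
  · omega
  · omega
  · omega
  · omega

theorem Qop_app (F : ℕ → ℕ → Module.End ℂ M) (μ : ℕ → ℤ) {s k : ℕ} (h : k ≤ s) (x : M) :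
    Qop F μ s k x = ∑ j ∈ Finset.Icc k s, bco μ s k j • Qop F μ s (j + 1) (F k j x) := by
  rw [Qop_rec F μ h, LinearMap.sum_apply]
  refine Finset.sum_congr rfl fun j _ => ?_
  rw [Module.End.mul_apply, Fm, LinearMap.smul_apply, map_smul]; rfl

variable {N : ℕ} (ρ : SLRep N M)

theorem EF1 {m k j : ℕ} (hm : 1 ≤ m) (hmN : m ≤ N) (hk : 1 ≤ k) (hkj : k ≤ j) (hj : j ≤ N)
    (h1 : m ≠ k) (h2 : m ≠ j) (x : M) : ρ.E m m (ρ.F k j x) = ρ.F k j (ρ.E m m x) := by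
  rw [lie_app (ρ.hEF m m k j hm le_rfl hmN hk hkj hj)]
  simp [h1, h2]

theorem EF2 {m k : ℕ} (hmN : m ≤ N) (hk : 1 ≤ k) (hkj : k < m) (x : M) :
    ρ.E m m (ρ.F k m x) = ρ.F k m (ρ.E m m x) + ρ.F k (m - 1) x := by
  rw [lie_app (ρ.hEF m m k m (by omega) le_rfl hmN hk (by omega) hmN)]
  simp [hkj, hkj.ne', hkj.not_gt]

theorem EF3 {m j : ℕ} (hm : 1 ≤ m) (hkj : m < j) (hj : j ≤ N) (x : M) :
    ρ.E m m (ρ.F m j x) = ρ.F m j (ρ.E m m x) - ρ.F (m + 1) j x := by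
  rw [lie_app (ρ.hEF m m m j hm le_rfl (by omega) hm (by omega) hj)]
  simp [hkj, hkj.ne, hkj.not_gt, sub_eq_add_neg]

theorem EF4 {m : ℕ} (hm : 1 ≤ m) (hj : m ≤ N) (x : M) :
    ρ.E m m (ρ.F m m x) = ρ.F m m (ρ.E m m x) + ρ.H m x := by
  rw [lie_app (ρ.hEF m m m m hm le_rfl hj hm le_rfl hj)]
  simp

theorem HF1 {m k j : ℕ} (hm : 1 ≤ m) (hmN : m ≤ N) (hk : 1 ≤ k) (hkj : k ≤ j) (hj : j ≤ N) (x : M) :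
    ρ.H m (ρ.F k j x) = ρ.F k j (ρ.H m x) - ((pair m k j : ℤ) : ℂ) • ρ.F k j x := by
  rw [lie_app (ρ.hHF m k j hm hmN hk hkj hj)]
  simp [sub_eq_add_neg]

theorem Qcomm (μ : ℕ → ℤ) {m s : ℕ} (hm : 1 ≤ m) (hmN : m ≤ N) (hs : s ≤ N) :
    ∀ d k : ℕ, s + 1 - k = d → 1 ≤ k → k ≤ s + 1 → (m < k ∨ s < m) → ∀ x,
      ρ.E m m (Qop ρ.F μ s k x) = Qop ρ.F μ s k (ρ.E m m x) := by
  intro d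
  induction d using Nat.strong_induction_on with
  | _ d ih =>
    intro k hd hk hks hmk x
    rcases Nat.lt_or_ge s k with h | h
    · obtain rfl : k = s + 1 := by omega
      rw [Qop_top]; simp
    · rw [Qop_app _ _ h, Qop_app _ _ h, map_sum]
      refine Finset.sum_congr rfl fun j hj => ?_
      rw [Finset.mem_Icc] at hj
      rw [map_smul, ih (s + 1 - (j + 1)) (by omega) (j + 1) rfl (by omega) (by omega) (by omega),
        EF1 ρ hm hmN hk hj.1 (by omega) (by omega) (by omega)]

theorem Q2 (μ : ℕ → ℤ) {m s : ℕ} (hm : 1 ≤ m) (hms : m ≤ s) (hs : s ≤ N) (x : M) :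
    ρ.E m m (Qop ρ.F μ s m x) = Qop ρ.F μ s m (ρ.E m m x) + Qop ρ.F μ s (m + 1) (ρ.H m x)
      - ((mus μ (m + 1) s : ℤ) : ℂ) • Qop ρ.F μ s (m + 1) x := by
  rw [Qop_app _ _ hms, Qop_app _ _ hms, map_sum, Icc_ins hms, Finset.sum_insert (by simp),
    Finset.sum_insert (by simp)]
  have h1 : ∀ j ∈ Finset.Icc (m + 1) s,
      ρ.E m m (bco μ s m j • Qop ρ.F μ s (j + 1) (ρ.F m j x)) =
      bco μ s m j • Qop ρ.F μ s (j + 1) (ρ.F m j (ρ.E m m x)) -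
      ((mus μ (m + 1) s : ℤ) : ℂ) • bco μ s (m + 1) j • Qop ρ.F μ s (j + 1) (ρ.F (m + 1) j x) := by
    intro j hj
    rw [Finset.mem_Icc] at hj
    rw [map_smul, Qcomm ρ μ hm (by omega) hs _ _ rfl (by omega) (by omega) (by omega),
      EF3 ρ hm (by omega) (by omega), map_sub, smul_sub, smul_smul _ (bco μ s (m+1) j),
      ← bco_left μ s hj.1]
  rw [Finset.sum_congr rfl h1, Finset.sum_sub_distrib, ← Finset.smul_sum, bco_self, one_smul,
    one_smul, Qcomm ρ μ hm (by omega) hs _ _ rfl (by omega) (by omega) (by omega),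
    EF4 ρ hm (by omega), map_add]
  rcases Nat.lt_or_ge m s with h | h
  · rw [← Qop_app _ _ (show m + 1 ≤ s by omega)]; abel
  · obtain rfl : m = s := by omega
    simp [mus]

theorem Q3 (μ : ℕ → ℤ) {m s : ℕ} (hms : m ≤ s) (hs : s ≤ N) :
    ∀ d k : ℕ, s + 1 - k = d → 1 ≤ k → k < m → ∀ x, ρ.H m x = ((μ m : ℤ) : ℂ) • x →
      ρ.E m m (Qop ρ.F μ s k x) = Qop ρ.F μ s k (ρ.E m m x) := by
  intro d
  induction d using Nat.strong_induction_on with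
  | _ d ih =>
    intro k hd hk hkm x hx
    rw [Qop_app _ _ (show k ≤ s by omega), Qop_app _ _ (show k ≤ s by omega), map_sum]
    have h1 : ∀ j ∈ Finset.Icc k s,
      ρ.E m m (bco μ s k j • Qop ρ.F μ s (j + 1) (ρ.F k j x)) =
      bco μ s k j • Qop ρ.F μ s (j + 1) (ρ.F k j (ρ.E m m x)) +
      ((if j = m - 1 then bco μ s k j * ((μ m + 1 - mus μ (m + 1) s : ℤ) : ℂ) else 0) +
        (if j = m then bco μ s k j else 0)) • Qop ρ.F μ s (m + 1) (ρ.F k (m - 1) x) := by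
      intro j hj
      rw [Finset.mem_Icc] at hj
      rw [map_smul]
      rcases lt_trichotomy (j + 1) m with h | h | h
      · rw [ih _ (by omega) (j + 1) rfl (by omega) h, EF1 ρ (by omega) (by omega) hk hj.1 (by omega)
          (by omega) (by omega), if_neg (by omega), if_neg (by omega)]
        · simp
        · rw [HF1 ρ (by omega) (by omega) hk hj.1 (by omega), hx, pair, if_neg (by omega),
            if_neg (by omega), if_neg (by omega), if_neg (by omega)]
          simp
      · subst h
        rw [Q2 ρ μ (by omega) hms hs, EF1 ρ (by omega) (by omega) hk hj.1 (by omega)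
          (by omega) (by omega), HF1 ρ (by omega) (by omega) hk hj.1 (by omega), hx, pair,
          if_neg (by omega), if_neg (by omega), if_neg (by omega), if_pos (by omega),
          if_pos (by omega), if_neg (by omega)]
        simp only [Nat.add_sub_cancel, map_smul, map_sub, Int.cast_sub, Int.cast_add, Int.cast_one,
          Int.cast_zero]
        module
      · rw [Qcomm ρ μ (by omega) (by omega) hs _ _ rfl (by omega) (by omega) (by omega)]
        rcases Nat.lt_or_ge m j with h' | h'
        · rw [EF1 ρ (by omega) (by omega) hk hj.1 (by omega)
            (by omega) (by omega), if_neg (by omega), if_neg (by omega)]; simp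
        · obtain rfl : j = m := by omega
          rw [EF2 ρ (by omega) hk hkm, if_neg (by omega), if_pos rfl, map_add, smul_add, zero_add]
    rw [Finset.sum_congr rfl h1, Finset.sum_add_distrib, ← Finset.sum_smul, Finset.sum_add_distrib,
      Finset.sum_ite_eq', Finset.sum_ite_eq', if_pos (by rw [Finset.mem_Icc]; omega),
      if_pos (by rw [Finset.mem_Icc]; omega)]
    have h2 : bco μ s k m = bco μ s k (m - 1) * ((mus μ m s : ℤ) : ℂ) := by
      have := bco_succ μ s (show k ≤ m - 1 by omega)
      rwa [show m - 1 + 1 = m by omega] at this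
    rw [h2, ← mul_add, mus_rec μ hms]
    push_cast
    rw [show ((μ m : ℂ) + 1 - (mus μ (m + 1) s : ℂ) + ((mus μ (m + 1) s : ℂ) - ((μ m : ℂ) + 1))) = 0 by ring]
    simp

end PartB

section PartB2
variable {M : Type} [AddCommGroup M] [Module ℂ M] {n : ℕ} (σ : SLRep (n + 1) M)

theorem pair_add (l k j : ℕ) (hl : 1 ≤ l) (hk : 1 ≤ k) (hj : k ≤ j) :
    pair l 1 k + pair l (k + 1) (j + 1) = pair l 1 (j + 1) := by
  unfold pair; split_ifs <;> omega

theorem Qwt (μ : ℕ → ℤ) {l s : ℕ} (hl : 1 ≤ l) (hln : l ≤ n + 1) (hs : s ≤ n) (τ : ℤ) :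
    ∀ d k : ℕ, s + 1 - k = d → 1 ≤ k → k ≤ s + 1 → ∀ x,
      σ.H l x = ((τ - pair l 1 k : ℤ) : ℂ) • x →
      σ.H l (Qop (Fr n σ) μ s k x) = ((τ - pair l 1 (s + 1) : ℤ) : ℂ) • Qop (Fr n σ) μ s k x := by
  intro d
  induction d using Nat.strong_induction_on with
  | _ d ih =>
    intro k hd hk hks x hx
    rcases Nat.lt_or_ge s k with h | h
    · obtain rfl : k = s + 1 := by omega
      rw [Qop_top]; simpa using hx
    · rw [Qop_app _ _ h, map_sum, Finset.smul_sum]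
      refine Finset.sum_congr rfl fun j hj => ?_
      rw [Finset.mem_Icc] at hj
      rw [map_smul, ih (s + 1 - (j + 1)) (by omega) (j + 1) rfl (by omega) (by omega), smul_comm]
      rw [Fr, HF1 σ hl hln (by omega) (by omega) (by omega), hx, ← pair_add l k j hl hk hj.1]
      push_cast
      rw [map_smul]
      module

theorem EP {m k : ℕ} (hm : 1 ≤ m) (hmn : m ≤ n) (hk : 1 ≤ k) (hkn : k ≤ n + 1) (x : M) :
    Er n σ m m (Pr n σ k x) = Pr n σ k (Er n σ m m x) + if m + 1 = k then Pr n σ m x else 0 := by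
  unfold Er Pr
  rw [lie_app (σ.hEF (m+1) (m+1) 1 k (by omega) le_rfl (by omega) le_rfl hk hkn)]
  rw [if_neg (by omega), if_neg (by omega), if_neg (by omega), if_neg (by omega)]
  congr 1
  by_cases h : m + 1 = k
  · rw [if_pos h, if_pos (by omega)]; simp
  · rw [if_neg h, if_neg (by omega)]; simp

theorem PhiOp_app (F : ℕ → ℕ → Module.End ℂ M) (P : ℕ → Module.End ℂ M)
    (μ : ℕ → ℤ) {i : ℕ} (hi : 1 ≤ i) (x : M) :
    PhiOp F P μ i x = ∑ k ∈ Finset.Icc 1 i, bco μ (i - 1) 0 (k - 1) • Qop F μ (i - 1) k (P k x) := by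
  obtain ⟨i, rfl⟩ : ∃ j, i = j + 1 := ⟨i - 1, by omega⟩
  rw [Finset.sum_Icc_succ_top (by omega), PhiOp, LinearMap.add_apply, LinearMap.sum_apply, add_comm]
  congr 1
  · refine Finset.sum_congr rfl fun k _ => ?_
    rw [Module.End.mul_apply, Pm, LinearMap.smul_apply, map_smul]; rfl
  · simp only [Nat.add_sub_cancel]
    rw [Qop_top]; rfl

theorem Phi_wt (μ : ℕ → ℤ) {i l : ℕ} (hi : 1 ≤ i) (hin : i ≤ n + 1) (hl : 1 ≤ l) (hln : l ≤ n + 1)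
    {w : M} {τ : ℤ} (hw : σ.H l w = (τ : ℂ) • w) :
    σ.H l (PhiOp (Fr n σ) (Pr n σ) μ i w) =
      ((τ - pair l 1 i : ℤ) : ℂ) • PhiOp (Fr n σ) (Pr n σ) μ i w := by
  rw [PhiOp_app _ _ _ hi, map_sum, Finset.smul_sum]
  refine Finset.sum_congr rfl fun k hk => ?_
  rw [Finset.mem_Icc] at hk
  rw [map_smul, smul_comm, Qwt σ μ hl hln (by omega) τ _ k rfl hk.1 (by omega),
    show i - 1 + 1 = i by omega]
  rw [Pr, HF1 σ hl hln le_rfl hk.1 (by omega), hw, map_smul]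
  push_cast
  module

theorem Phi_E (μ : ℕ → ℤ) {i m : ℕ} (hi : 1 ≤ i) (hin : i ≤ n + 1) (hm : 1 ≤ m) (hmn : m ≤ n)
    {w : M} (hw : IsHWvec n (Hr n σ) (Er n σ) μ w) :
    Er n σ m m (PhiOp (Fr n σ) (Pr n σ) μ i w) = 0 := by
  have hE : Er n σ m m w = 0 := hw.2 m m hm le_rfl hmn
  have hH : σ.H (m + 1) w = ((μ m : ℤ) : ℂ) • w := hw.1 m hm hmn
  rw [PhiOp_app _ _ _ hi, map_sum]
  set Y := Qop (Fr n σ) μ (i - 1) (m + 1) (Pr n σ m w) with hY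
  have key : ∀ k ∈ Finset.Icc 1 i,
      Er n σ m m (bco μ (i - 1) 0 (k - 1) • Qop (Fr n σ) μ (i - 1) k (Pr n σ k w)) =
      ((if k = m + 1 then bco μ (i - 1) 0 m else 0) +
       (if k = m then (if m + 1 ≤ i then - bco μ (i - 1) 0 m else 0) else 0)) • Y := by
    intro k hk
    rw [Finset.mem_Icc] at hk
    rw [map_smul]
    by_cases h0 : m < k ∨ i - 1 < m
    · have := Qcomm (res n σ) μ hm hmn (show i - 1 ≤ n by omega) _ k rfl hk.1 (by omega) h0
        (Pr n σ k w)
      change Er n σ m m (Qop (Fr n σ) μ (i - 1) k _) = Qop (Fr n σ) μ (i - 1) k (Er n σ m m _) at this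
      rw [this, EP σ hm hmn hk.1 (by omega), hE, map_zero, zero_add]
      by_cases h1 : m + 1 = k
      · subst h1
        rw [if_pos rfl, if_pos rfl, if_neg (by omega), add_zero]; rfl
      · rw [if_neg h1, if_neg (by omega)]
        by_cases h2 : k = m
        · rw [if_pos h2, if_neg (by omega)]; simp
        · rw [if_neg h2]; simp
    · have hPH : σ.H (m + 1) (Pr n σ k w) =
          ((μ m - pair (m + 1) 1 k : ℤ) : ℂ) • Pr n σ k w := by
        rw [Pr, HF1 σ (by omega) (by omega) le_rfl hk.1 (by omega), hH, map_smul]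
        push_cast; module
      rcases Nat.lt_or_ge k m with h | h
      · have := Q3 (res n σ) μ (show m ≤ i - 1 by omega) (show i - 1 ≤ n by omega) _ k rfl hk.1 h
          (Pr n σ k w) (by
            change σ.H (m + 1) _ = _
            rw [hPH, pair, if_neg (by omega), if_neg (by omega), if_neg (by omega),
              if_neg (by omega)]; simp)
        change Er n σ m m (Qop (Fr n σ) μ (i - 1) k _) = Qop (Fr n σ) μ (i - 1) k (Er n σ m m _) at this
        rw [this, EP σ hm hmn hk.1 (by omega), hE, map_zero, zero_add, if_neg (by omega),
          if_neg (by omega), if_neg (by omega)]; simp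
      · obtain rfl : k = m := by omega
        have := Q2 (res n σ) μ hk.1 (show k ≤ i - 1 by omega) (show i - 1 ≤ n by omega) (Pr n σ k w)
        change Er n σ k k (Qop (Fr n σ) μ (i - 1) k _) = Qop (Fr n σ) μ (i - 1) k (Er n σ k k _) +
          Qop (Fr n σ) μ (i - 1) (k + 1) (σ.H (k + 1) _) - _ • Qop (Fr n σ) μ (i - 1) (k + 1) _ at this
        rw [this, EP σ hm hmn hk.1 (by omega), hE, map_zero, zero_add, if_neg (by omega), hPH,
          map_smul, ← hY, if_neg (by omega), if_pos rfl, if_pos (by omega), map_zero]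
        have h2 : bco μ (i-1) 0 k = bco μ (i-1) 0 (k - 1) * ((mus μ k (i-1) : ℤ) : ℂ) := by
          have := bco_succ μ (i-1) (show 0 ≤ k - 1 by omega)
          rwa [show k - 1 + 1 = k by omega] at this
        rw [h2, mus_rec μ (show k ≤ i - 1 by omega), pair, if_neg (by omega), if_neg (by omega),
          if_neg (by omega), if_pos rfl]
        push_cast
        module
  rw [Finset.sum_congr rfl key, ← Finset.sum_smul, Finset.sum_add_distrib, Finset.sum_ite_eq',
    Finset.sum_ite_eq']
  by_cases h : m + 1 ≤ i
  · rw [if_pos (by rw [Finset.mem_Icc]; omega), if_pos (by rw [Finset.mem_Icc]; omega), if_pos h]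
    simp
  · rw [if_neg (by rw [Finset.mem_Icc]; omega), if_neg h]; simp

theorem wsh_pair (μ : ℕ → ℤ) (i l : ℕ) (hl : 1 ≤ l) : wsh i μ l = μ l - pair (l + 1) 1 i := by
  unfold wsh pair; split_ifs <;> omega

theorem Phi_hw (μ : ℕ → ℤ) {i : ℕ} (hi : 1 ≤ i) (hin : i ≤ n + 1)
    {w : M} (hw : IsHWvec n (Hr n σ) (Er n σ) μ w) :
    IsHWvec n (Hr n σ) (Er n σ) (wsh i μ) (PhiOp (Fr n σ) (Pr n σ) μ i w) := by
  refine ⟨fun l hl hln => ?_, ?_⟩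
  · rw [wsh_pair μ i l hl]
    exact Phi_wt σ μ hi hin (by omega) (by omega) (hw.1 l hl hln)
  · exact E_of_simple (res n σ) fun m hm hmn => Phi_E σ μ hi hin hm hmn hw

end PartB2
end Paper


namespace Paper
section PartC
open MvPolynomial

/-- positive definite hermitian form -/
structure PForm (M : Type) [AddCommGroup M] [Module ℂ M] where
  B : M → M →ₗ[ℂ] ℂ
  symm : ∀ x y, (starRingEnd ℂ) (B y x) = B x y
  nonneg : ∀ x, 0 ≤ (B x x).re
  definite : ∀ x, B x x = 0 → x = 0

theorem sub_lie' {M : Type} [AddCommGroup M] [Module ℂ M] (A B C : Module.End ℂ M) :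
    ⁅A - B, C⁆ = ⁅A, C⁆ - ⁅B, C⁆ := by
  simp only [Ring.lie_def]; noncomm_ring

theorem lie_sub' {M : Type} [AddCommGroup M] [Module ℂ M] (A B C : Module.End ℂ M) :
    ⁅A, B - C⁆ = ⁅A, B⁆ - ⁅A, C⁆ := by
  simp only [Ring.lie_def]; noncomm_ring

/-- The representation built from operators satisfying the `gl` relations. -/
def ofG {M : Type} [AddCommGroup M] [Module ℂ M] (N : ℕ) (G : ℕ → ℕ → Module.End ℂ M)
    (hG : ∀ a b c d, ⁅G a b, G c d⁆ = (if b = c then G a d else 0) - (if a = d then G c b else 0)) :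
    SLRep N M where
  H i := G i i - G (i + 1) (i + 1)
  E p q := G p (q + 1)
  F p q := G (q + 1) p
  hHH i j _ _ _ _ := by
    rw [sub_lie', lie_sub', lie_sub', hG, hG, hG, hG]
    by_cases h : i = j
    · subst h; simp
    · have h' : ¬ j = i := fun e => h e.symm
      by_cases h1 : i = j + 1
      · subst h1; simp [show ¬ j + 1 + 1 = j by omega]
      · by_cases h2 : j = i + 1
        · subst h2; simp [show ¬ i = i + 1 + 1 by omega]
        · have h1' : ¬ j + 1 = i := fun e => h1 e.symm
          have h2' : ¬ i + 1 = j := fun e => h2 e.symm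
          simp [h, h', h1, h2, h1', h2']
  hHE i p q _ _ _ _ _ := by
    rw [sub_lie', hG, hG]
    have e : ((pair i p q : ℤ) : ℂ) • G p (q + 1) =
      (if i = p then G p (q + 1) else 0) + (if i = q then G p (q + 1) else 0)
      - (if i + 1 = p then G p (q + 1) else 0) - (if i = q + 1 then G p (q + 1) else 0) := by
      unfold pair
      push_cast
      simp only [sub_smul, add_smul, ite_smul, one_smul, zero_smul]
    rw [e]
    have h1 : (if i = p then G i (q + 1) else 0) = (if i = p then G p (q + 1) else 0) := by
      split_ifs with h <;> simp [h]
    have h2 : (if i = q + 1 then G p i else 0) = (if i = q + 1 then G p (q + 1) else 0) := by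
      split_ifs with h <;> simp [h]
    have h3 : (if i + 1 = p then G (i + 1) (q + 1) else 0) =
        (if i + 1 = p then G p (q + 1) else 0) := by
      split_ifs with h <;> simp [h]
    have h4 : (if i + 1 = q + 1 then G p (i + 1) else 0) = (if i = q then G p (q + 1) else 0) := by
      by_cases h : i = q <;> simp [h]
    rw [h1, h2, h3, h4]; abel
  hHF i p q _ _ _ _ _ := by
    rw [sub_lie', hG, hG]
    have e : (-((pair i p q : ℤ) : ℂ)) • G (q + 1) p =
      -((if i = p then G (q + 1) p else 0) + (if i = q then G (q + 1) p else 0)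
      - (if i + 1 = p then G (q + 1) p else 0) - (if i = q + 1 then G (q + 1) p else 0)) := by
      unfold pair
      push_cast
      simp only [neg_smul, sub_smul, add_smul, ite_smul, one_smul, zero_smul]
    rw [e]
    have h1 : (if i = p then G (q + 1) i else 0) = (if i = p then G (q + 1) p else 0) := by
      split_ifs with h <;> simp [h]
    have h2 : (if i = q + 1 then G i p else 0) = (if i = q + 1 then G (q + 1) p else 0) := by
      split_ifs with h <;> simp [h]
    have h3 : (if i + 1 = p then G (q + 1) (i + 1) else 0) =
        (if i + 1 = p then G (q + 1) p else 0) := by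
      split_ifs with h <;> simp [h]
    have h4 : (if i + 1 = q + 1 then G (i + 1) p else 0) = (if i = q then G (q + 1) p else 0) := by
      by_cases h : i = q <;> simp [h]
    rw [h1, h2, h3, h4]; abel
  hEE p q r s _ _ _ _ _ _ := by simp only [hG]
  hFF p q r s _ _ _ _ _ _ := by
    rw [hG]
  hEF p q r s _ _ _ _ _ _ := by
    have tel : ∀ q, p ≤ q → ∑ t ∈ Finset.Icc p q, (G t t - G (t + 1) (t + 1)) =
        G p p - G (q + 1) (q + 1) := by
      intro q hq
      induction q, hq using Nat.le_induction with
      | base => simp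
      | succ q hq ih => rw [Finset.sum_Icc_succ_top (by omega), ih]; abel
    rw [hG, tel q (by assumption)]
    rcases lt_trichotomy p r with h | h | h
    · have h' : ¬ p = r := by omega
      have h'' : ¬ r < p := by omega
      have h3 : r - 1 + 1 = r := by omega
      simp [h, h', h'', h3]
    · subst h
      rcases lt_trichotomy q s with h | h | h
      · have h' : ¬ q = s := by omega
        have h'' : ¬ s < q := by omega
        simp [h, h', h'']
      · subst h; simp
      · have h' : ¬ q = s := by omega
        have h'' : ¬ q < s := by omega
        simp [h, h', h'']
    · have h' : ¬ p = r := by omega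
      have h'' : ¬ p < r := by omega
      have h3 : p - 1 + 1 = p := by omega
      simp [h, h', h'', h3]

/-- the polynomial model -/
abbrev Tm : Type := MvPolynomial (ℕ × ℕ) ℂ

/-- polarization derivations -/
noncomputable def Dm (R a b : ℕ) : Derivation ℂ Tm Tm :=
  ∑ r ∈ Finset.range R, (X (r, a) : Tm) • pderiv (r, b)

theorem Dm_apply (R a b : ℕ) (p : Tm) :
    Dm R a b p = ∑ r ∈ Finset.range R, X (r, a) * pderiv (r, b) p := by
  unfold Dm
  rw [← Derivation.coeFnAddMonoidHom_apply, map_sum, Finset.sum_apply]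
  rfl

theorem Dm_X (R a b r c : ℕ) :
    Dm R a b (X (r, c)) = if r < R ∧ c = b then X (r, a) else 0 := by
  rw [Dm_apply]
  by_cases h : r < R ∧ c = b
  · obtain ⟨h, rfl⟩ := h
    rw [if_pos ⟨h, rfl⟩, Finset.sum_eq_single r]
    · rw [pderiv_X_self, mul_one]
    · intro r' _ hr'
      rw [pderiv_X_of_ne, mul_zero]
      intro e; exact hr' (Prod.ext_iff.1 e).1.symm
    · intro h'; simp [h] at h'
  · rw [if_neg h]
    apply Finset.sum_eq_zero
    intro r' hr'
    rw [pderiv_X_of_ne, mul_zero]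
    intro e
    rw [Prod.ext_iff] at e
    simp only at e
    rw [Finset.mem_range] at hr'
    exact h ⟨by omega, e.2⟩

theorem Dm_comm (R a b c d : ℕ) : ⁅Dm R a b, Dm R c d⁆ =
    (if b = c then Dm R a d else 0) - (if a = d then Dm R c b else 0) := by
  apply derivation_ext
  rintro ⟨r, s⟩
  rw [Derivation.commutator_apply, Derivation.sub_apply, Dm_X, Dm_X]
  have e1 : (if b = c then Dm R a d else 0) (X (r, s)) = if b = c then (if r < R ∧ s = d then X (r,a) else 0) else 0 := by
    split_ifs <;> simp [Dm_X, *]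
  have e2 : (if a = d then Dm R c b else 0) (X (r, s)) = if a = d then (if r < R ∧ s = b then X (r,c) else 0) else 0 := by
    split_ifs <;> simp [Dm_X, *]
  rw [e1, e2]
  congr 1
  · by_cases h : r < R ∧ s = d
    · rw [if_pos h, if_pos h, Dm_X]; simp [h.1, eq_comm]
    · simp [h]
  · by_cases h : r < R ∧ s = b
    · rw [if_pos h, if_pos h, Dm_X]; simp [h.1]
    · simp [h]

/-- as endomorphisms -/
noncomputable def Gm (R a b : ℕ) : Module.End ℂ Tm := (Dm R a b : Tm →ₗ[ℂ] Tm)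

theorem Gm_apply (R a b : ℕ) (p : Tm) : Gm R a b p = Dm R a b p := rfl

theorem Gm_comm (R a b c d : ℕ) : ⁅Gm R a b, Gm R c d⁆ =
    (if b = c then Gm R a d else 0) - (if a = d then Gm R c b else 0) := by
  apply LinearMap.ext
  intro p
  have := congrArg (fun D : Derivation ℂ Tm Tm => D p) (Dm_comm R a b c d)
  simp only [Derivation.commutator_apply, Derivation.sub_apply] at this
  rw [Ring.lie_def, LinearMap.sub_apply, LinearMap.sub_apply, Module.End.mul_apply,
    Module.End.mul_apply, Gm_apply, Gm_apply, Gm_apply, Gm_apply, this]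
  congr 1 <;> split_ifs <;> simp [Gm_apply]

/-- the model representation of `sl(n+2)` -/
noncomputable def repT (n : ℕ) : SLRep (n + 1) Tm := ofG (n + 1) (Gm (n + 1)) (Gm_comm (n + 1))

/-- multi factorial -/
def mfac (α : ℕ × ℕ →₀ ℕ) : ℕ := α.prod fun _ k => k.factorial

theorem mfac_pos (α : ℕ × ℕ →₀ ℕ) : 0 < mfac α :=
  Finset.prod_pos fun _ _ => Nat.factorial_pos _

theorem mfac_add (i : ℕ × ℕ) (α : ℕ × ℕ →₀ ℕ) :
    mfac (Finsupp.single i 1 + α) = (α i + 1) * mfac α := by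
  classical
  have h1 : mfac (Finsupp.single i 1 + α) =
      ∏ j ∈ insert i α.support, ((Finsupp.single i 1 + α : ℕ × ℕ →₀ ℕ) j).factorial := by
    apply Finsupp.prod_of_support_subset
    · intro j hj
      rw [Finsupp.mem_support_iff, Finsupp.add_apply] at hj
      by_cases h : i = j
      · subst h; simp
      · rw [Finsupp.single_eq_of_ne (Ne.symm h)] at hj
        simp at hj
        simp [hj]
    · intros; rfl
  have h2 : mfac α = ∏ j ∈ insert i α.support, (α j).factorial := by
    apply Finsupp.prod_of_support_subset
    · exact Finset.subset_insert _ _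
    · intros; rfl
  rw [h1, h2, ← Finset.mul_prod_erase _ _ (Finset.mem_insert_self i α.support),
    ← Finset.mul_prod_erase (insert i α.support) _ (Finset.mem_insert_self i α.support), ← mul_assoc]
  congr 1
  · rw [Finsupp.add_apply, Finsupp.single_eq_same, add_comm, Nat.factorial_succ]
  · refine Finset.prod_congr rfl fun j hj => ?_
    rw [Finset.mem_erase] at hj
    rw [Finsupp.add_apply, Finsupp.single_eq_of_ne hj.1, zero_add]

/-- Fischer form -/
noncomputable def fisch (p : Tm) : Tm →ₗ[ℂ] ℂ :=
  ∑ α ∈ p.support, ((mfac α : ℂ) * (starRingEnd ℂ) (coeff α p)) • lcoeff ℂ α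

theorem fisch_apply (p q : Tm) : fisch p q =
    ∑ α ∈ p.support, ((mfac α : ℂ) * (starRingEnd ℂ) (coeff α p)) * coeff α q := by
  unfold fisch
  rw [LinearMap.sum_apply]; rfl

theorem fisch_symm (p q : Tm) : (starRingEnd ℂ) (fisch q p) = fisch p q := by
  classical
  have h1 : fisch q p = ∑ α ∈ p.support ∪ q.support,
      ((mfac α : ℂ) * (starRingEnd ℂ) (coeff α q)) * coeff α p := by
    rw [fisch_apply]
    apply Finset.sum_subset Finset.subset_union_right
    intro α _ h
    rw [MvPolynomial.notMem_support_iff] at h; simp [h]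
  have h2 : fisch p q = ∑ α ∈ p.support ∪ q.support,
      ((mfac α : ℂ) * (starRingEnd ℂ) (coeff α p)) * coeff α q := by
    rw [fisch_apply]
    apply Finset.sum_subset Finset.subset_union_left
    intro α _ h
    rw [MvPolynomial.notMem_support_iff] at h; simp [h]
  rw [h1, h2, map_sum]
  refine Finset.sum_congr rfl fun α _ => ?_
  simp only [map_mul, map_natCast, Complex.conj_conj]; ring

theorem fisch_self (p : Tm) : fisch p p =
    ((∑ α ∈ p.support, (mfac α : ℝ) * Complex.normSq (coeff α p) : ℝ) : ℂ) := by
  rw [fisch_apply, Complex.ofReal_sum]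
  refine Finset.sum_congr rfl fun α _ => ?_
  rw [mul_assoc, mul_comm ((starRingEnd ℂ) _), Complex.mul_conj]; push_cast; rfl

/-- Fischer form bundled -/
noncomputable def fischF : PForm Tm where
  B := fisch
  symm := fisch_symm
  nonneg p := by
    rw [fisch_self, Complex.ofReal_re]
    exact Finset.sum_nonneg fun α _ => mul_nonneg (Nat.cast_nonneg _) (Complex.normSq_nonneg _)
  definite p hp := by
    rw [fisch_self, Complex.ofReal_eq_zero, Finset.sum_eq_zero_iff_of_nonneg (fun α _ =>
      mul_nonneg (Nat.cast_nonneg _) (Complex.normSq_nonneg _))] at hp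
    rw [← MvPolynomial.support_eq_empty, Finset.eq_empty_iff_forall_notMem]
    intro α hα
    have := hp α hα
    rw [mul_eq_zero, Complex.normSq_eq_zero] at this
    rcases this with h | h
    · have := mfac_pos α
      rw [Nat.cast_eq_zero] at h; omega
    · exact (mem_support_iff.1 hα) h

theorem fisch_X (i : ℕ × ℕ) (p q : Tm) : fisch (X i * p) q = fisch p (pderiv i q) := by
  rw [fisch_apply, fisch_apply, support_X_mul, Finset.sum_map]
  refine Finset.sum_congr rfl fun α _ => ?_
  simp only [addLeftEmbedding_apply]
  rw [coeff_X_mul, coeff_pderiv, mfac_add, add_comm α]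
  push_cast
  ring

theorem fisch_pderiv (i : ℕ × ℕ) (p q : Tm) : fisch (pderiv i p) q = fisch p (X i * q) := by
  rw [← fisch_symm, ← fisch_X, fisch_symm]

theorem PForm.add_left {M : Type} [AddCommGroup M] [Module ℂ M] (b : PForm M) (x y z : M) :
    b.B (x + y) z = b.B x z + b.B y z := by
  rw [← b.symm, map_add, map_add, b.symm, b.symm]

theorem PForm.smul_left {M : Type} [AddCommGroup M] [Module ℂ M] (b : PForm M) (c : ℂ) (x z : M) :
    b.B (c • x) z = (starRingEnd ℂ) c * b.B x z := by
  rw [← b.symm, map_smul, smul_eq_mul, map_mul, b.symm]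

theorem PForm.zero_left {M : Type} [AddCommGroup M] [Module ℂ M] (b : PForm M) (z : M) :
    b.B 0 z = 0 := by
  have := b.smul_left 0 0 z
  simpa using this

theorem PForm.sum_left {M ι : Type} [AddCommGroup M] [Module ℂ M] (b : PForm M) (s : Finset ι)
    (f : ι → M) (z : M) : b.B (∑ i ∈ s, f i) z = ∑ i ∈ s, b.B (f i) z := by
  rw [← b.symm, map_sum, map_sum]
  exact Finset.sum_congr rfl fun _ _ => b.symm _ _

theorem PForm.sub_left {M : Type} [AddCommGroup M] [Module ℂ M] (b : PForm M) (x y z : M) :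
    b.B (x - y) z = b.B x z - b.B y z := by
  rw [← b.symm, map_sub, map_sub, b.symm, b.symm]

theorem Gm_adj (R a b : ℕ) (p q : Tm) : fischF.B (Gm R a b p) q = fischF.B p (Gm R b a q) := by
  rw [Gm_apply, Gm_apply, Dm_apply, Dm_apply, fischF.sum_left, map_sum]
  refine Finset.sum_congr rfl fun r _ => ?_
  change fisch _ _ = fisch _ _
  rw [fisch_X, fisch_pderiv]

end PartC
end Paper


namespace Paper
section PartD
open MvPolynomial

theorem der_prod {ι : Type} [DecidableEq ι] (D : Derivation ℂ Tm Tm) (s : Finset ι) (f : ι → Tm) :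
    D (∏ i ∈ s, f i) = ∑ c ∈ s, ∏ i ∈ s, if i = c then D (f i) else f i := by
  induction s using Finset.induction_on with
  | empty => simp
  | insert a s ha ih =>
    rw [Finset.prod_insert ha, Derivation.leibniz, ih, Finset.sum_insert ha, Finset.prod_insert ha,
      if_pos rfl, smul_eq_mul, smul_eq_mul, add_comm]
    congr 1
    · rw [mul_comm]
      congr 1
      refine Finset.prod_congr rfl fun i hi => ?_
      rw [if_neg]; rintro rfl; exact ha hi
    · rw [Finset.mul_sum]
      refine Finset.sum_congr rfl fun c hc => ?_
      rw [Finset.prod_insert ha, if_neg]; rintro rfl; exact ha hc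

/-- minors -/
noncomputable def mi (i : ℕ) (κ : Fin i → ℕ) : Tm :=
  (Matrix.of fun r c : Fin i => (X (r.1, κ c) : Tm)).det

theorem mi_zero {i : ℕ} {κ : Fin i → ℕ} {c c' : Fin i} (h : c ≠ c') (h' : κ c = κ c') :
    mi i κ = 0 := by
  apply Matrix.det_zero_of_column_eq h
  intro k; simp [h']

theorem Dm_mi (R a b : ℕ) {i : ℕ} (hi : i ≤ R) (κ : Fin i → ℕ) :
    Dm R a b (mi i κ) = ∑ c, if κ c = b then mi i (Function.update κ c a) else 0 := by
  unfold mi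
  rw [Matrix.det_apply, map_sum]
  simp only [Matrix.of_apply]
  have : ∀ τ : Equiv.Perm (Fin i), Dm R a b (Equiv.Perm.sign τ • ∏ c, (X ((τ c).1, κ c) : Tm)) =
      ∑ c, if κ c = b then Equiv.Perm.sign τ • ∏ d, (X ((τ d).1, Function.update κ c a d) : Tm) else 0 := by
    intro τ
    have h1 : Dm R a b (∏ c, (X ((τ c).1, κ c) : Tm)) = 
       ∑ c, if κ c = b then ∏ d, (X ((τ d).1, Function.update κ c a d) : Tm) else 0 := by
      rw [der_prod]
      refine Finset.sum_congr rfl fun c _ => ?_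
      split_ifs with h
      · refine Finset.prod_congr rfl fun d _ => ?_
        split_ifs with h2
        · subst h2
          rw [Dm_X, if_pos ⟨by have := (τ d).2; omega, h⟩, Function.update_self]
        · rw [Function.update_of_ne h2]
      · apply Finset.prod_eq_zero (Finset.mem_univ c)
        rw [if_pos rfl, Dm_X, if_neg (fun h' => h h'.2)]
    rcases Int.units_eq_one_or (Equiv.Perm.sign τ) with h | h
    · rw [h, one_smul, h1]; simp
    · rw [h, Units.neg_smul, one_smul, map_neg, h1, ← Finset.sum_neg_distrib]
      refine Finset.sum_congr rfl fun c _ => ?_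
      split_ifs <;> simp
  simp_rw [this]
  rw [Finset.sum_comm]
  refine Finset.sum_congr rfl fun c _ => ?_
  split_ifs with h
  · rw [Matrix.det_apply]; rfl
  · simp

theorem Dm_mi_zero (R a b : ℕ) {i : ℕ} (hi : i ≤ R) (κ : Fin i → ℕ)
    (h : ∀ c, κ c = b → ∃ c', c' ≠ c ∧ κ c' = a) : Dm R a b (mi i κ) = 0 := by
  rw [Dm_mi R a b hi]
  apply Finset.sum_eq_zero
  intro c _
  split_ifs with hc
  · obtain ⟨c', h1, h2⟩ := h c hc
    apply mi_zero h1
    rw [Function.update_of_ne h1, Function.update_self, h2]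
  · rfl

/-- leading minors -/
noncomputable def dl (i : ℕ) : Tm := mi i fun c => c.1 + 1
/-- shifted minors -/
noncomputable def dl' (i : ℕ) : Tm := mi i fun c => if c.1 = 0 then i + 1 else c.1 + 1

theorem dl_zero {R a b i : ℕ} (hi : i ≤ R) (ha : 1 ≤ a) (hab : a < b) : Dm R a b (dl i) = 0 := by
  apply Dm_mi_zero R a b hi
  intro c hc
  refine ⟨⟨a - 1, by omega⟩, ?_, by simp; omega⟩
  rw [Ne, Fin.ext_iff]; simp; omega

theorem dl'_zero {R a b i : ℕ} (hi : i ≤ R) (ha : 2 ≤ a) (hab : a < b) : Dm R a b (dl' i) = 0 := by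
  apply Dm_mi_zero R a b hi
  intro c hc
  have := c.2
  have : a ≤ i := by split_ifs at hc <;> omega
  refine ⟨⟨a - 1, by omega⟩, ?_, ?_⟩
  · rw [Ne, Fin.ext_iff]; simp only; split_ifs at hc <;> omega
  · simp only; rw [if_neg (by omega)]; omega

theorem dl'_zero1 {R b i : ℕ} (hi : i ≤ R) (hb : i + 1 < b) : Dm R 1 b (dl' i) = 0 := by
  apply Dm_mi_zero R 1 b hi
  intro c hc
  have := c.2
  split_ifs at hc <;> omega

theorem dl'_one {R i : ℕ} (hi : i ≤ R) (hi1 : 1 ≤ i) : Dm R 1 (i + 1) (dl' i) = dl i := by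
  unfold dl'
  rw [Dm_mi R _ _ hi, Finset.sum_eq_single (⟨0, hi1⟩ : Fin i)]
  · rw [if_pos (by simp)]
    unfold dl
    congr 1
    funext c
    by_cases h : c = ⟨0, hi1⟩
    · subst h; simp
    · rw [Function.update_of_ne h, if_neg]
      intro h'; exact h (Fin.ext h')
  · intro c _ hc
    rw [if_neg]
    have h0 : c.1 ≠ 0 := fun h' => hc (Fin.ext h')
    rw [if_neg h0]; have := c.2; omega
  · simp

theorem dl_wt {R a i : ℕ} (hi : i ≤ R) (ha : 1 ≤ a) :
    Dm R a a (dl i) = (if a ≤ i then (1 : ℂ) else 0) • dl i := by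
  unfold dl
  rw [Dm_mi R _ _ hi]
  split_ifs with h
  · rw [Finset.sum_eq_single (⟨a - 1, by omega⟩ : Fin i)]
    · rw [if_pos (by simp; omega), one_smul]
      congr 1
      funext c
      by_cases h : c = ⟨a - 1, by omega⟩
      · subst h; simp; omega
      · rw [Function.update_of_ne h]
    · intro c _ hc
      rw [if_neg]
      intro h'
      apply hc; apply Fin.ext; simp; omega
    · simp
  · rw [zero_smul]
    apply Finset.sum_eq_zero
    intro c _
    rw [if_neg]; have := c.2; omega

theorem dl_wt' {R a i : ℕ} (hi : i ≤ R) (ha : 1 ≤ a) :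
    (Dm R a a - Dm R (a + 1) (a + 1)) (dl i) = (if a = i then (1 : ℂ) else 0) • dl i := by
  rw [Derivation.sub_apply, dl_wt hi ha, dl_wt hi (by omega), ← sub_smul]
  congr 1
  split_ifs <;> first | omega | simp

theorem der_prod_zero (D : Derivation ℂ Tm Tm) (s : Finset ℕ) (f : ℕ → Tm)
    (h : ∀ i ∈ s, D (f i) = 0) : D (∏ i ∈ s, f i) = 0 := by
  rw [der_prod]
  apply Finset.sum_eq_zero
  intro c hc
  apply Finset.prod_eq_zero hc
  rw [if_pos rfl, h c hc]

theorem der_prod_eig (D : Derivation ℂ Tm Tm) (s : Finset ℕ) (f : ℕ → Tm) (k : ℕ → ℂ)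
    (h : ∀ i ∈ s, D (f i) = k i • f i) : D (∏ i ∈ s, f i) = (∑ i ∈ s, k i) • ∏ i ∈ s, f i := by
  rw [der_prod, Finset.sum_smul]
  refine Finset.sum_congr rfl fun c hc => ?_
  rw [← Finset.mul_prod_erase s _ hc, ← Finset.mul_prod_erase s f hc, if_pos rfl, h c hc,
    smul_mul_assoc]
  congr 2
  refine Finset.prod_congr rfl fun i hi => ?_
  rw [if_neg (Finset.ne_of_mem_erase hi)]

theorem der_pow (D : Derivation ℂ Tm Tm) (x : Tm) (m : ℕ) (c : ℂ) (h : D x = c • x) :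
    D (x ^ m) = ((m : ℂ) * c) • x ^ m := by
  induction m with
  | zero => simp
  | succ m ih =>
    rw [pow_succ, Derivation.leibniz, h, ih]
    simp only [smul_eq_mul, MvPolynomial.smul_eq_C_mul]
    push_cast
    simp only [map_mul, map_add, map_natCast, map_one]
    ring

/-- monomials in minors -/
noncomputable def tK (R : ℕ) (lam K : ℕ → ℕ) : Tm :=
  ∏ j ∈ Finset.Icc 1 R, dl j ^ (lam j - K j) * dl' j ^ K j

theorem tK_zero (R : ℕ) (lam K : ℕ → ℕ) (D : Derivation ℂ Tm Tm)
    (h1 : ∀ j, 1 ≤ j → j ≤ R → D (dl j) = 0)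
    (h2 : ∀ j, 1 ≤ j → j ≤ R → K j ≠ 0 → D (dl' j) = 0) : D (tK R lam K) = 0 := by
  apply der_prod_zero
  intro j hj
  rw [Finset.mem_Icc] at hj
  rw [Derivation.leibniz, Derivation.leibniz_pow, Derivation.leibniz_pow, h1 j hj.1 hj.2]
  by_cases h : K j = 0
  · simp [h]
  · rw [h2 j hj.1 hj.2 h]; simp

theorem tK_Er (n : ℕ) (lam K : ℕ → ℕ) {p q : ℕ} (hp : 1 ≤ p) (hpq : p ≤ q) :
    Er n (repT n) p q (tK (n + 1) lam K) = 0 := by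
  change Dm (n + 1) (p + 1) (q + 1 + 1) _ = 0
  apply tK_zero
  · intro j _ hj; exact dl_zero hj (by omega) (by omega)
  · intro j _ hj _; exact dl'_zero hj (by omega) (by omega)

theorem tK_E1 (n : ℕ) (lam K K' : ℕ → ℕ) {i : ℕ} (hi : 1 ≤ i) (hin : i ≤ n + 1)
    (h0 : ∀ j, i < j → K j = 0) (h1 : K i ≤ lam i) (h2 : K i = K' i + 1)
    (h3 : ∀ j, j ≠ i → K j = K' j) :
    (repT n).E 1 i (tK (n + 1) lam K) = (K i : ℂ) • tK (n + 1) lam K' := by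
  change Dm (n + 1) 1 (i + 1) _ = _
  have hmem : i ∈ Finset.Icc 1 (n + 1) := Finset.mem_Icc.2 ⟨hi, hin⟩
  have hd : Dm (n + 1) 1 (i + 1) (dl i) = 0 := dl_zero hin le_rfl (by omega)
  have hd' : Dm (n + 1) 1 (i + 1) (dl' i) = dl i := dl'_one hin hi
  unfold tK
  rw [← Finset.mul_prod_erase _ _ hmem, ← Finset.mul_prod_erase _ _ hmem, Derivation.leibniz,
    der_prod_zero, Derivation.leibniz, Derivation.leibniz_pow, Derivation.leibniz_pow, hd, hd']
  · have : ∏ x ∈ (Finset.Icc 1 (n + 1)).erase i, dl x ^ (lam x - K x) * dl' x ^ K x =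
      ∏ x ∈ (Finset.Icc 1 (n + 1)).erase i, dl x ^ (lam x - K' x) * dl' x ^ K' x := by
      refine Finset.prod_congr rfl fun j hj => ?_
      rw [h3 j (Finset.ne_of_mem_erase hj)]
    rw [this, show lam i - K' i = (lam i - K i) + 1 by omega, show K' i = K i - 1 by omega]
    simp only [smul_zero, zero_add, smul_eq_mul, add_zero, nsmul_eq_mul,
      MvPolynomial.smul_eq_C_mul, map_natCast]
    ring
  · intro j hj
    have hji := Finset.ne_of_mem_erase hj
    have hj := Finset.mem_Icc.1 (Finset.mem_of_mem_erase hj)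
    rw [Derivation.leibniz, Derivation.leibniz_pow, Derivation.leibniz_pow,
      dl_zero hj.2 le_rfl (by omega)]
    rcases lt_or_gt_of_ne hji with h | h
    · rw [dl'_zero1 hj.2 (by omega)]; simp
    · rw [h0 j h]; simp

theorem t_hw (n : ℕ) (lam : ℕ → ℕ) :
    IsHWvec (n + 1) (repT n).H (repT n).E (fun i => (lam i : ℤ)) (tK (n + 1) lam 0) := by
  constructor
  · intro i h1 h2
    change (Dm (n + 1) i i - Dm (n + 1) (i + 1) (i + 1)) _ = _
    unfold tK
    simp only [Pi.zero_apply, Nat.sub_zero, pow_zero, mul_one]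
    rw [der_prod_eig _ _ _ (fun j => (lam j : ℂ) * (if i = j then (1 : ℂ) else 0))]
    · congr 1
      simp [h1, h2]
    · intro j hj
      exact der_pow _ _ _ _ (dl_wt' (Finset.mem_Icc.1 hj).2 h1)
  · intro p q h1 h2 h3
    change Dm (n + 1) p (q + 1) _ = 0
    apply tK_zero
    · intro j _ hj; exact dl_zero hj (by omega) (by omega)
    · intro j _ hj h; exact absurd rfl h

theorem t_ne (R : ℕ) (lam : ℕ → ℕ) : tK R lam 0 ≠ 0 := by
  intro h
  have := congrArg (eval (fun z : ℕ × ℕ => if z.2 = z.1 + 1 then (1 : ℂ) else 0)) h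
  unfold tK at this
  rw [map_prod, map_zero, Finset.prod_eq_zero_iff] at this
  obtain ⟨j, _, hj⟩ := this
  simp only [Pi.zero_apply, Nat.sub_zero, pow_zero, mul_one] at hj
  rw [map_pow] at hj
  have h1 : eval (fun z : ℕ × ℕ => if z.2 = z.1 + 1 then (1 : ℂ) else 0) (dl j) = 1 := by
    unfold dl mi
    rw [RingHom.map_det]
    have : (RingHom.mapMatrix (eval (fun z : ℕ × ℕ => if z.2 = z.1 + 1 then (1 : ℂ) else 0)))
      (Matrix.of fun r c : Fin j => (X (r.1, c.1 + 1) : Tm)) = 1 := by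
      ext r c
      simp [Matrix.one_apply, Fin.ext_iff, eq_comm]
    rw [this, Matrix.det_one]
  rw [h1, one_pow] at hj
  exact one_ne_zero hj

end PartD
end Paper


namespace Paper
section PartE

variable {M : Type} [AddCommGroup M] [Module ℂ M]

theorem sum_shift1 (N : ℕ) (c : ℕ → ℂ) (p : ℕ) (hp : 1 ≤ p) (hpN : p ≤ N) (h0 : c 0 = 0) :
    ∑ i ∈ Finset.Icc 1 N, c i * (if i + 1 = p then 1 else 0) = c (p - 1) := by
  by_cases h : p = 1
  · subst h
    rw [Nat.sub_self, h0]
    apply Finset.sum_eq_zero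
    intro i hi
    rw [Finset.mem_Icc] at hi
    rw [if_neg (by omega), mul_zero]
  · rw [Finset.sum_eq_single (p - 1)]
    · rw [if_pos (by omega), mul_one]
    · intro i _ hi
      rw [if_neg (by omega), mul_zero]
    · intro h'; rw [Finset.mem_Icc] at h'; omega

theorem sum_shift2 (N : ℕ) (c : ℕ → ℂ) (q : ℕ) (hp : 1 ≤ q) (hpN : q ≤ N + 1) (h0 : c (N + 1) = 0) :
    ∑ i ∈ Finset.Icc 1 N, c i * (if i = q then 1 else 0) = c q := by
  by_cases h : q = N + 1
  · subst h
    rw [h0]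
    apply Finset.sum_eq_zero
    intro i hi
    rw [Finset.mem_Icc] at hi
    rw [if_neg (by omega), mul_zero]
  · rw [Finset.sum_eq_single q]
    · rw [if_pos (by omega), mul_one]
    · intro i _ hi
      rw [if_neg (by omega), mul_zero]
    · intro h'; rw [Finset.mem_Icc] at h'; omega

theorem pair_sum (N p q : ℕ) (hp : 1 ≤ p) (hpq : p ≤ q) (hq : q ≤ N) :
    ∑ i ∈ Finset.Icc 1 N, ((i : ℂ) * (N + 1 - i) / 2) * ((pair i p q : ℤ) : ℂ) =
      ((q - p + 1 : ℕ) : ℂ) := by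
  have e : ∀ i ∈ Finset.Icc 1 N, ((i : ℂ) * (N + 1 - i) / 2) * ((pair i p q : ℤ) : ℂ) =
      ((i : ℂ) * (N + 1 - i) / 2) * (if i = p then 1 else 0) +
      ((i : ℂ) * (N + 1 - i) / 2) * (if i = q then 1 else 0) -
      ((i : ℂ) * (N + 1 - i) / 2) * (if i + 1 = p then 1 else 0) -
      ((i : ℂ) * (N + 1 - i) / 2) * (if i = q + 1 then 1 else 0) := by
    intro i _
    unfold pair
    push_cast
    ring
  rw [Finset.sum_congr rfl e]
  simp only [Finset.sum_add_distrib, Finset.sum_sub_distrib]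
  rw [sum_shift2 N (fun i => (i : ℂ) * (N + 1 - i) / 2) p hp (by omega) (by push_cast; ring),
    sum_shift2 N (fun i => (i : ℂ) * (N + 1 - i) / 2) q (by omega) (by omega) (by push_cast; ring),
    sum_shift1 N (fun i => (i : ℂ) * (N + 1 - i) / 2) p hp (by omega) (by push_cast; ring),
    sum_shift2 N (fun i => (i : ℂ) * (N + 1 - i) / 2) (q+1) (by omega) (by omega) (by push_cast; ring)]
  push_cast [Nat.cast_sub hp, Nat.cast_sub hpq]
  ring

theorem hw_not_nM {N : ℕ} (ρ : SLRep N M) {μ : ℕ → ℤ} {w : M} (hw : IsHWvec N ρ.H ρ.E μ w)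
    (hw0 : w ≠ 0) (hgen : slGen N ρ.H ρ.E ρ.F w = ⊤) : w ∉ nM N ρ.F := by
  set D : Module.End ℂ M := ∑ i ∈ Finset.Icc 1 N, ((i : ℂ) * (N + 1 - i) / 2) • ρ.H i with hD
  set d : ℂ := ∑ i ∈ Finset.Icc 1 N, ((i : ℂ) * (N + 1 - i) / 2) * ((μ i : ℤ) : ℂ) with hd
  have hDw : D w = d • w := by
    rw [hD, hd, LinearMap.sum_apply, Finset.sum_smul]
    refine Finset.sum_congr rfl fun i hi => ?_
    rw [Finset.mem_Icc] at hi
    rw [LinearMap.smul_apply, hw.1 i hi.1 hi.2, smul_smul]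
  have hDF : ∀ p q, 1 ≤ p → p ≤ q → q ≤ N → ∀ x,
      D (ρ.F p q x) = ρ.F p q (D x) - ((q - p + 1 : ℕ) : ℂ) • ρ.F p q x := by
    intro p q h1 h2 h3 x
    rw [← pair_sum N p q h1 h2 h3, hD, LinearMap.sum_apply, LinearMap.sum_apply, map_sum,
      Finset.sum_smul, ← Finset.sum_sub_distrib]
    refine Finset.sum_congr rfl fun i hi => ?_
    rw [Finset.mem_Icc] at hi
    rw [LinearMap.smul_apply, LinearMap.smul_apply, HF1 ρ hi.1 hi.2 h1 h2 h3, smul_sub, map_smul,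
      smul_smul]
  have hmap : ∀ p q, 1 ≤ p → p ≤ q → q ≤ N → ∀ (m : ℕ) x, x ∈ D.eigenspace (d - m) →
      ρ.F p q x ∈ D.eigenspace (d - ((m + (q - p) + 1 : ℕ) : ℂ)) := by
    intro p q h1 h2 h3 m x hx
    rw [Module.End.mem_eigenspace_iff] at *
    rw [hDF p q h1 h2 h3, hx, map_smul, ← sub_smul]
    congr 1
    push_cast; ring
  set A : Submodule ℂ M := ⨆ m : ℕ, D.eigenspace (d - m) with hA
  set A' : Submodule ℂ M := ⨆ m : ℕ, D.eigenspace (d - ((m + 1 : ℕ) : ℂ)) with hA'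
  have hA'A : A' ≤ A := iSup_le fun m => le_iSup (fun m : ℕ => D.eigenspace (d - m)) (m + 1)
  have hF : ∀ p q, 1 ≤ p → p ≤ q → q ≤ N → ∀ x ∈ A, ρ.F p q x ∈ A' := by
    intro p q h1 h2 h3 x hx
    have : A ≤ A'.comap (ρ.F p q) := by
      refine iSup_le fun m => ?_
      intro x hx
      rw [Submodule.mem_comap]
      exact Submodule.mem_iSup_of_mem (m + (q - p)) (hmap p q h1 h2 h3 m x hx)
    exact this hx
  have hwA : w ∈ D.eigenspace d := by
    rw [Module.End.mem_eigenspace_iff]; exact hDw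
  have hAtop : A = ⊤ := by
    rw [eq_top_iff, ← hgen]
    apply slGen_le ρ hw
    · intro p q h1 h2 h3 x hx
      exact hA'A (hF p q h1 h2 h3 x hx)
    · refine Submodule.mem_iSup_of_mem 0 ?_
      simpa using hwA
  have hn : nM N ρ.F ≤ A' := by
    apply Submodule.span_le.2
    rintro y ⟨p, q, x, h1, h2, h3, rfl⟩
    exact hF p q h1 h2 h3 x (by rw [hAtop]; trivial)
  intro hwn
  have hind := (Module.End.eigenspaces_iSupIndep D) d
  have hle : A' ≤ ⨆ j, ⨆ (_ : j ≠ d), D.eigenspace j := by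
    refine iSup_le fun m => ?_
    refine le_iSup₂_of_le (d - ((m + 1 : ℕ) : ℂ)) ?_ le_rfl
    intro h
    rw [sub_eq_self, Nat.cast_eq_zero] at h
    omega
  exact hw0 (Submodule.disjoint_def.1 hind w hwA (hle (hn hwn)))

theorem lie_prodMap {M' : Type} [AddCommGroup M'] [Module ℂ M'] {A B C : Module.End ℂ M}
    {A' B' C' : Module.End ℂ M'} {T : Module.End ℂ (M × M')} (h : ⁅A, B⁆ = C) (h' : ⁅A', B'⁆ = C')
    (hT : ∀ x y, T (x, y) = (C x, C' y)) :
    ⁅(LinearMap.prodMap A A' : Module.End ℂ (M × M')), LinearMap.prodMap B B'⁆ = T := by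
  apply LinearMap.ext
  rintro ⟨x, y⟩
  rw [hT, ← h, ← h']
  simp [Ring.lie_def]

/-- product representation -/
def prodRep {M' : Type} [AddCommGroup M'] [Module ℂ M'] {N : ℕ} (ρ : SLRep N M) (ρ' : SLRep N M') :
    SLRep N (M × M') where
  H i := LinearMap.prodMap (ρ.H i) (ρ'.H i)
  E p q := LinearMap.prodMap (ρ.E p q) (ρ'.E p q)
  F p q := LinearMap.prodMap (ρ.F p q) (ρ'.F p q)
  hHH i j h1 h2 h3 h4 := lie_prodMap (ρ.hHH i j h1 h2 h3 h4) (ρ'.hHH i j h1 h2 h3 h4) (by simp [Prod.ext_iff])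
  hHE i p q h1 h2 h3 h4 h5 := lie_prodMap (ρ.hHE i p q h1 h2 h3 h4 h5)
    (ρ'.hHE i p q h1 h2 h3 h4 h5) (by simp [Prod.ext_iff])
  hHF i p q h1 h2 h3 h4 h5 := lie_prodMap (ρ.hHF i p q h1 h2 h3 h4 h5)
    (ρ'.hHF i p q h1 h2 h3 h4 h5) (by simp [Prod.ext_iff])
  hEE p q r s h1 h2 h3 h4 h5 h6 := lie_prodMap (ρ.hEE p q r s h1 h2 h3 h4 h5 h6)
    (ρ'.hEE p q r s h1 h2 h3 h4 h5 h6) (by intro x y; split_ifs <;> simp [Prod.ext_iff])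
  hFF p q r s h1 h2 h3 h4 h5 h6 := lie_prodMap (ρ.hFF p q r s h1 h2 h3 h4 h5 h6)
    (ρ'.hFF p q r s h1 h2 h3 h4 h5 h6) (by intro x y; split_ifs <;> simp [Prod.ext_iff])
  hEF p q r s h1 h2 h3 h4 h5 h6 := lie_prodMap (ρ.hEF p q r s h1 h2 h3 h4 h5 h6)
    (ρ'.hEF p q r s h1 h2 h3 h4 h5 h6) (by
      intro x y
      have e : (∑ t ∈ Finset.Icc p q, (LinearMap.prodMap (ρ.H t) (ρ'.H t) : Module.End ℂ (M × M'))) (x, y)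
        = ((∑ t ∈ Finset.Icc p q, ρ.H t) x, (∑ t ∈ Finset.Icc p q, ρ'.H t) y) := by
        simp only [LinearMap.sum_apply, LinearMap.prodMap_apply]
        rw [Prod.ext_iff, Prod.fst_sum, Prod.snd_sum]
        exact ⟨rfl, rfl⟩
      simp only [LinearMap.add_apply]
      rw [← Prod.mk_add_mk, ← Prod.mk_add_mk, ← Prod.mk_add_mk, ← Prod.mk_add_mk]
      congr 1
      · congr 1
        · congr 1
          · congr 1
            · split_ifs
              · exact e
              · rfl
            · split_ifs <;> simp [Prod.ext_iff]
          · split_ifs <;> simp [Prod.ext_iff]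
        · split_ifs <;> simp [Prod.ext_iff]
      · split_ifs <;> simp [Prod.ext_iff])

theorem repT_EF (n p q : ℕ) (x y : Tm) :
    fischF.B ((repT n).E p q x) y = fischF.B x ((repT n).F p q y) := Gm_adj _ _ _ _ _

theorem repT_FE (n p q : ℕ) (x y : Tm) :
    fischF.B ((repT n).F p q x) y = fischF.B x ((repT n).E p q y) := Gm_adj _ _ _ _ _

theorem repT_HH (n i : ℕ) (x y : Tm) :
    fischF.B ((repT n).H i x) y = fischF.B x ((repT n).H i y) := by
  change fischF.B (Gm (n+1) i i x - Gm (n+1) (i+1) (i+1) x) y = 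
    fischF.B x (Gm (n+1) i i y - Gm (n+1) (i+1) (i+1) y)
  rw [fischF.sub_left, map_sub, Gm_adj, Gm_adj]

theorem embed (n : ℕ) (σ : SLRep (n + 1) M) (lam : ℕ → ℕ) (v : M) (hv0 : v ≠ 0)
    (hv : IsHWvec (n + 1) σ.H σ.E (fun i => (lam i : ℤ)) v)
    (hgen : slGen (n + 1) σ.H σ.E σ.F v = ⊤)
    (hirr : ∀ Ns : Submodule ℂ M, slInvariant (n + 1) σ.H σ.E σ.F Ns → Ns = ⊥ ∨ Ns = ⊤) :
    ∃ ι : M →ₗ[ℂ] Tm, Function.Injective ι ∧ ι v = tK (n + 1) lam 0 ∧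
      (∀ i, 1 ≤ i → i ≤ n + 1 → ∀ x, ι (σ.H i x) = (repT n).H i (ι x)) ∧
      (∀ p q, 1 ≤ p → p ≤ q → q ≤ n + 1 → ∀ x, ι (σ.E p q x) = (repT n).E p q (ι x)) ∧
      (∀ p q, 1 ≤ p → p ≤ q → q ≤ n + 1 → ∀ x, ι (σ.F p q x) = (repT n).F p q (ι x)) := by
  set t := tK (n + 1) lam 0 with ht
  set τ := prodRep σ (repT n) with hτ
  have htw := t_hw n lam
  have hτw : IsHWvec (n + 1) τ.H τ.E (fun i => (lam i : ℤ)) (v, t) := by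
    constructor
    · intro i h1 h2
      change (σ.H i v, (repT n).H i t) = _
      rw [hv.1 i h1 h2, htw.1 i h1 h2]; rfl
    · intro p q h1 h2 h3
      change (σ.E p q v, (repT n).E p q t) = _
      rw [hv.2 p q h1 h2 h3, htw.2 p q h1 h2 h3]; rfl
  set Z := slGen (n + 1) τ.H τ.E τ.F (v, t) with hZ
  have hZi : slInvariant (n + 1) τ.H τ.E τ.F Z := slGen_inv _ _ _ _ _
  have hZH : ∀ i, 1 ≤ i → i ≤ n + 1 → ∀ x y, (x, y) ∈ Z → (σ.H i x, (repT n).H i y) ∈ Z :=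
    fun i h1 h2 x y h => hZi.1 i h1 h2 _ h
  have hZE : ∀ p q, 1 ≤ p → p ≤ q → q ≤ n + 1 → ∀ x y, (x, y) ∈ Z →
      (σ.E p q x, (repT n).E p q y) ∈ Z := fun p q h1 h2 h3 x y h => (hZi.2 p q h1 h2 h3 _ h).1
  have hZF : ∀ p q, 1 ≤ p → p ≤ q → q ≤ n + 1 → ∀ x y, (x, y) ∈ Z →
      (σ.F p q x, (repT n).F p q y) ∈ Z := fun p q h1 h2 h3 x y h => (hZi.2 p q h1 h2 h3 _ h).2
  have hsurj : ∀ x, ∃ y, (x, y) ∈ Z := by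
    have : (⊤ : Submodule ℂ M) ≤ Z.map (LinearMap.fst ℂ M Tm) := by
      rw [← hgen]
      apply slGen_min
      · constructor
        · rintro i h1 h2 _ ⟨⟨x, y⟩, h, rfl⟩
          exact ⟨_, hZH i h1 h2 x y h, rfl⟩
        · rintro p q h1 h2 h3 _ ⟨⟨x, y⟩, h, rfl⟩
          exact ⟨⟨_, hZE p q h1 h2 h3 x y h, rfl⟩, ⟨_, hZF p q h1 h2 h3 x y h, rfl⟩⟩
      · exact ⟨_, slGen_self _ _ _ _ _, rfl⟩
    intro x
    obtain ⟨⟨x', y⟩, h, rfl⟩ := this (Submodule.mem_top (x := x))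
    exact ⟨y, h⟩
  have hinj : ∀ y, ((0 : M), y) ∈ Z → y = 0 := by
    have h1 : ∀ y, ((0 : M), y) ∈ Z → y ∈ nM (n + 1) (repT n).F := by
      intro y hy
      have := slGen_le_nM τ hτw hy
      rw [Submodule.mem_sup] at this
      obtain ⟨a, ha, z, hz, haz⟩ := this
      rw [Submodule.mem_span_singleton] at ha
      obtain ⟨c, rfl⟩ := ha
      have hz1 : nM (n + 1) τ.F ≤ (nM (n + 1) σ.F).prod (nM (n + 1) (repT n).F) := by
        apply Submodule.span_le.2
        rintro _ ⟨p, q, ⟨x, y⟩, h1, h2, h3, rfl⟩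
        exact ⟨mem_nM h1 h2 h3 x, mem_nM h1 h2 h3 y⟩
      obtain ⟨hz1, hz2⟩ := hz1 hz
      rw [Prod.ext_iff] at haz
      simp only [Prod.fst_add, Prod.snd_add, Prod.smul_fst, Prod.smul_snd] at haz
      by_cases hc : c = 0
      · subst hc
        have h2 := haz.2
        rw [zero_smul, zero_add] at h2
        rw [← h2]; exact hz2
      · exfalso
        apply hw_not_nM σ hv hv0 hgen
        have e : v = c⁻¹ • (- z.1) := by
          rw [← eq_neg_of_add_eq_zero_left haz.1, smul_smul, inv_mul_cancel₀ hc, one_smul]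
        rw [e]
        exact Submodule.smul_mem _ _ (Submodule.neg_mem _ hz1)
    have h2 : ∀ y ∈ nM (n + 1) (repT n).F, fischF.B t y = 0 := by
      intro y hy
      have : nM (n + 1) (repT n).F ≤ LinearMap.ker (fischF.B t) := by
        apply Submodule.span_le.2
        rintro _ ⟨p, q, x, h1, h2, h3, rfl⟩
        change fischF.B t _ = 0
        rw [← repT_EF, htw.2 p q h1 h2 h3, fischF.zero_left]
      exact this hy
    set Kp : Submodule ℂ Tm :=
      { carrier := {x | ∀ y, ((0 : M), y) ∈ Z → fischF.B x y = 0}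
        add_mem' := fun {a b} ha hb y hy => by rw [fischF.add_left, ha y hy, hb y hy, add_zero]
        zero_mem' := fun y _ => fischF.zero_left y
        smul_mem' := fun c x hx y hy => by rw [fischF.smul_left, hx y hy, mul_zero] } with hKp
    have h3 : slGen (n + 1) (repT n).H (repT n).E (repT n).F t ≤ Kp := by
      apply slGen_min
      · constructor
        · intro i a1 a2 x hx y hy
          rw [repT_HH]
          apply hx
          have := hZH i a1 a2 0 y hy
          rwa [map_zero] at this
        · intro p q a1 a2 a3 x hx
          constructor
          · intro y hy
            rw [repT_EF]
            apply hx
            have := hZF p q a1 a2 a3 0 y hy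
            rwa [map_zero] at this
          · intro y hy
            rw [repT_FE]
            apply hx
            have := hZE p q a1 a2 a3 0 y hy
            rwa [map_zero] at this
      · intro y hy
        exact h2 y (h1 y hy)
    intro y hy
    apply fischF.definite
    refine h3 ?_ y hy
    have h4 : Z ≤ (slGen (n + 1) (repT n).H (repT n).E (repT n).F t).comap (LinearMap.snd ℂ M Tm) := by
      have hi := slGen_inv (n + 1) (repT n).H (repT n).E (repT n).F t
      apply slGen_min
      · constructor
        · rintro i a1 a2 ⟨x, y⟩ h
          exact hi.1 i a1 a2 y h
        · rintro p q a1 a2 a3 ⟨x, y⟩ h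
          exact ⟨(hi.2 p q a1 a2 a3 y h).1, (hi.2 p q a1 a2 a3 y h).2⟩
      · exact slGen_self _ _ _ _ _
    exact h4 hy
  choose f hf using hsurj
  have huniq : ∀ x y, (x, y) ∈ Z → f x = y := by
    intro x y h
    have := Z.sub_mem (hf x) h
    rw [Prod.mk_sub_mk, sub_self] at this
    exact sub_eq_zero.1 (hinj _ this)
  let ι : M →ₗ[ℂ] Tm :=
    { toFun := f
      map_add' := fun x y => huniq _ _ (Z.add_mem (hf x) (hf y))
      map_smul' := fun c x => huniq _ _ (Z.smul_mem c (hf x)) }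
  have hH : ∀ i, 1 ≤ i → i ≤ n + 1 → ∀ x, ι (σ.H i x) = (repT n).H i (ι x) :=
    fun i h1 h2 x => huniq _ _ (hZH i h1 h2 _ _ (hf x))
  have hE : ∀ p q, 1 ≤ p → p ≤ q → q ≤ n + 1 → ∀ x, ι (σ.E p q x) = (repT n).E p q (ι x) :=
    fun p q h1 h2 h3 x => huniq _ _ (hZE p q h1 h2 h3 _ _ (hf x))
  have hF : ∀ p q, 1 ≤ p → p ≤ q → q ≤ n + 1 → ∀ x, ι (σ.F p q x) = (repT n).F p q (ι x) :=
    fun p q h1 h2 h3 x => huniq _ _ (hZF p q h1 h2 h3 _ _ (hf x))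
  have hιv : ι v = t := huniq _ _ (slGen_self _ _ _ _ _)
  refine ⟨ι, ?_, hιv, hH, hE, hF⟩
  rw [← LinearMap.ker_eq_bot]
  have hk : slInvariant (n + 1) σ.H σ.E σ.F (LinearMap.ker ι) := by
    constructor
    · intro i h1 h2 x hx
      rw [LinearMap.mem_ker] at *
      rw [hH i h1 h2, hx, map_zero]
    · intro p q h1 h2 h3 x hx
      rw [LinearMap.mem_ker] at hx
      rw [LinearMap.mem_ker, LinearMap.mem_ker]
      rw [hE p q h1 h2 h3, hF p q h1 h2 h3, hx, map_zero, map_zero]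
      exact ⟨rfl, rfl⟩
  rcases hirr _ hk with h | h
  · exact h
  · exfalso
    have : ι v = 0 := by rw [← LinearMap.mem_ker, h]; trivial
    rw [hιv] at this
    exact t_ne _ _ this

/-- pulled back form -/
noncomputable def PForm.pull (b : PForm Tm) (ι : M →ₗ[ℂ] Tm) (hι : Function.Injective ι) : PForm M where
  B x := b.B (ι x) ∘ₗ ι
  symm x y := b.symm _ _
  nonneg x := b.nonneg _
  definite x h := by
    have := b.definite _ h
    exact hι (by rw [this, map_zero])

end PartE
end Paper


namespace Paper
section PartF

variable {M : Type} [AddCommGroup M] [Module ℂ M]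

/-- all the data used in the final argument -/
structure Ctx (n : ℕ) (σ : SLRep (n + 1) M) (lam : ℕ → ℕ) (v : M) where
  b : PForm M
  aH : ∀ i, 1 ≤ i → i ≤ n + 1 → ∀ x y, b.B (σ.H i x) y = b.B x (σ.H i y)
  aE : ∀ p q, 1 ≤ p → p ≤ q → q ≤ n + 1 → ∀ x y, b.B (σ.E p q x) y = b.B x (σ.F p q y)
  aF : ∀ p q, 1 ≤ p → p ≤ q → q ≤ n + 1 → ∀ x y, b.B (σ.F p q x) y = b.B x (σ.E p q y)
  θ : (ℕ → ℕ) → M →ₗ[ℂ] ℂ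
  θF : ∀ K p q, 1 ≤ p → p ≤ q → q ≤ n → ∀ x, θ K (Fr n σ p q x) = 0
  θP : ∀ (K K' : ℕ → ℕ) (i : ℕ), 1 ≤ i → i ≤ n + 1 → (∀ j, i < j → K j = 0) → K i ≤ lam i →
    K i = K' i + 1 → (∀ j, j ≠ i → K j = K' j) → ∀ x, θ K (Pr n σ i x) = (K i : ℂ) * θ K' x
  θv : θ 0 v ≠ 0
  hv : IsHWvec (n + 1) σ.H σ.E (fun i => (lam i : ℤ)) v
  hgen : slGen (n + 1) σ.H σ.E σ.F v = ⊤

theorem ctx_exists (n : ℕ) (σ : SLRep (n + 1) M) (lam : ℕ → ℕ) (v : M) (hv0 : v ≠ 0)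
    (hv : IsHWvec (n + 1) σ.H σ.E (fun i => (lam i : ℤ)) v)
    (hgen : slGen (n + 1) σ.H σ.E σ.F v = ⊤)
    (hirr : ∀ Ns : Submodule ℂ M, slInvariant (n + 1) σ.H σ.E σ.F Ns → Ns = ⊥ ∨ Ns = ⊤) :
    Nonempty (Ctx n σ lam v) := by
  obtain ⟨ι, hι, hιv, hH, hE, hF⟩ := embed n σ lam v hv0 hv hgen hirr
  refine ⟨{ b := fischF.pull ι hι, aH := ?_, aE := ?_, aF := ?_,
            θ := fun K => fischF.B (tK (n + 1) lam K) ∘ₗ ι, θF := ?_, θP := ?_, θv := ?_,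
            hv := hv, hgen := hgen }⟩
  · intro i h1 h2 x y
    change fischF.B (ι _) (ι _) = fischF.B (ι _) (ι _)
    rw [hH i h1 h2, hH i h1 h2, repT_HH]
  · intro p q h1 h2 h3 x y
    change fischF.B (ι _) (ι _) = fischF.B (ι _) (ι _)
    rw [hE p q h1 h2 h3, hF p q h1 h2 h3, repT_EF]
  · intro p q h1 h2 h3 x y
    change fischF.B (ι _) (ι _) = fischF.B (ι _) (ι _)
    rw [hE p q h1 h2 h3, hF p q h1 h2 h3, repT_FE]
  · intro K p q h1 h2 h3 x
    change fischF.B _ (ι (σ.F (p + 1) (q + 1) x)) = 0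
    rw [hF _ _ (by omega) (by omega) (by omega), ← repT_EF]
    have := tK_Er n lam K h1 h2
    unfold Er at this
    rw [this, fischF.zero_left]
  · intro K K' i h1 h2 h3 h4 h5 h6 x
    change fischF.B _ (ι (σ.F 1 i x)) = _ * fischF.B _ (ι x)
    rw [hF _ _ (by omega) (by omega) (by omega), ← repT_EF,
      tK_E1 n lam K K' h1 h2 h3 h4 h5 h6, fischF.smul_left, map_natCast]
  · change fischF.B _ (ι v) ≠ 0
    rw [hιv]
    exact fun h => t_ne _ _ (fischF.definite _ h)

theorem ker_nM {N : ℕ} (ρ : SLRep N M) (b : PForm M)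
    (aE : ∀ p q, 1 ≤ p → p ≤ q → q ≤ N → ∀ x y, b.B (ρ.E p q x) y = b.B x (ρ.F p q y)) {z : M}
    (hz : ∀ p q, 1 ≤ p → p ≤ q → q ≤ N → ρ.E p q z = 0) {y : M} (hy : y ∈ nM N ρ.F) :
    b.B z y = 0 := by
  have : nM N ρ.F ≤ LinearMap.ker (b.B z) := by
    apply Submodule.span_le.2
    rintro _ ⟨p, q, x, h1, h2, h3, rfl⟩
    change b.B z _ = 0
    rw [← aE p q h1 h2 h3, hz p q h1 h2 h3, b.zero_left]
  exact this hy

variable {n : ℕ} {σ : SLRep (n + 1) M} {lam : ℕ → ℕ} {v : M}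

theorem Ctx.aEr (C : Ctx n σ lam v) : ∀ p q, 1 ≤ p → p ≤ q → q ≤ n → ∀ x y,
    C.b.B (Er n σ p q x) y = C.b.B x (Fr n σ p q y) :=
  fun p q h1 h2 h3 x y => C.aE (p + 1) (q + 1) (by omega) (by omega) (by omega) x y

/-- killed by the raising operators of the small algebra -/
def Kil (n : ℕ) (σ : SLRep (n + 1) M) (z : M) : Prop :=
  ∀ p q, 1 ≤ p → p ≤ q → q ≤ n → Er n σ p q z = 0

theorem Ctx.kil_nM (C : Ctx n σ lam v) {z : M} (hz : Kil n σ z) {y : M}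
    (hy : y ∈ nM n (Fr n σ)) : C.b.B z y = 0 :=
  ker_nM (res n σ) C.b C.aEr hz hy

theorem sl2_str (C : Ctx n σ lam v) {i : ℕ} (h1 : 1 ≤ i) (h2 : i ≤ n + 1) (k : ℕ) :
    σ.H i ((σ.F i i ^ k) v) = ((lam i : ℂ) - 2 * k) • (σ.F i i ^ k) v ∧
    σ.E i i ((σ.F i i ^ (k + 1)) v) = (((k : ℂ) + 1) * (lam i - k)) • (σ.F i i ^ k) v := by
  have hH : ∀ k : ℕ, σ.H i ((σ.F i i ^ k) v) = ((lam i : ℂ) - 2 * k) • (σ.F i i ^ k) v := by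
    intro k
    induction k with
    | zero =>
      have := C.hv.1 i h1 h2
      simpa using this
    | succ k ih =>
      rw [pow_succ', Module.End.mul_apply, HF1 σ h1 h2 h1 le_rfl h2, ih, map_smul, ← sub_smul]
      congr 1
      have : pair i i i = 2 := by unfold pair; simp
      rw [this]; push_cast; ring
  refine ⟨hH k, ?_⟩
  induction k with
  | zero =>
    rw [zero_add, pow_one, EF4 σ h1 h2, C.hv.2 i i h1 le_rfl h2]
    have := hH 0
    simpa using this
  | succ k ih =>
    rw [pow_succ', Module.End.mul_apply, EF4 σ h1 h2, ih, map_smul, hH (k + 1), ← Module.End.mul_apply,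
      ← pow_succ', ← add_smul]
    congr 1
    push_cast; ring

theorem f_pow (C : Ctx n σ lam v) {i : ℕ} (h1 : 1 ≤ i) (h2 : i ≤ n + 1) :
    (σ.F i i ^ (lam i + 1)) v = 0 := by
  apply C.b.definite
  apply ker_nM σ C.b C.aE
  · apply E_of_simple σ
    intro m hm hmn
    by_cases h : m = i
    · subst h
      rw [(sl2_str C h1 h2 (lam m)).2, sub_self, mul_zero, zero_smul]
    · have : ∀ k : ℕ, σ.E m m ((σ.F i i ^ k) v) = 0 := by
        intro k
        induction k with
        | zero => exact C.hv.2 m m hm le_rfl hmn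
        | succ k ih =>
          rw [pow_succ', Module.End.mul_apply, EF1 σ hm hmn h1 le_rfl h2 h h, ih, map_zero]
      exact this _
  · rw [pow_succ', Module.End.mul_apply]
    exact mem_nM h1 le_rfl h2 _

theorem f_pow' (C : Ctx n σ lam v) {i k : ℕ} (h1 : 1 ≤ i) (h2 : i ≤ n + 1) (hk : lam i < k) :
    (σ.F i i ^ k) v = 0 := by
  obtain ⟨d, rfl⟩ : ∃ d, k = d + (lam i + 1) := ⟨k - (lam i + 1), by omega⟩
  rw [pow_add, Module.End.mul_apply, f_pow C h1 h2, map_zero]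

/-- entries in range -/
def InR (n : ℕ) (L : List ℕ) : Prop := ∀ i ∈ L, 1 ≤ i ∧ i ≤ n + 1

/-- products of `P` -/
def pl (n : ℕ) (σ : SLRep (n + 1) M) (L : List ℕ) (x : M) : M :=
  L.foldl (fun y i => Pr n σ i y) x

theorem pl_snoc (L : List ℕ) (i : ℕ) (x : M) : pl n σ (L ++ [i]) x = Pr n σ i (pl n σ L x) := by
  simp [pl]

theorem P_comm {i j : ℕ} (hi : 1 ≤ i ∧ i ≤ n + 1) (hj : 1 ≤ j ∧ j ≤ n + 1) (x : M) :
    Pr n σ i (Pr n σ j x) = Pr n σ j (Pr n σ i x) := by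
  unfold Pr
  rw [lie_app (σ.hFF 1 i 1 j le_rfl hi.1 hi.2 le_rfl hj.1 hj.2)]
  rw [if_neg (by omega), if_neg (by omega)]; simp

theorem FP {p q j : ℕ} (h1 : 1 ≤ p) (h2 : p ≤ q) (h3 : q ≤ n) (hj : 1 ≤ j ∧ j ≤ n + 1) (x : M) :
    Fr n σ p q (Pr n σ j x) = Pr n σ j (Fr n σ p q x) + if p = j then Pr n σ (q + 1) x else 0 := by
  unfold Fr Pr
  rw [lie_app (σ.hFF (p+1) (q+1) 1 j (by omega) (by omega) (by omega) le_rfl hj.1 hj.2)]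
  rw [if_neg (show ¬ q + 1 + 1 = 1 by omega)]
  congr 1
  by_cases h : p = j
  · rw [if_pos h, if_pos (by omega)]; simp
  · rw [if_neg h, if_neg (by omega)]; simp

theorem pl_perm {L L' : List ℕ} (h : L.Perm L') (hL : InR n L) (x : M) :
    pl n σ L x = pl n σ L' x := by
  unfold pl
  apply h.foldl_eq'
  intro a ha c hc z
  exact P_comm (hL c hc) (hL a ha) z

/-- shifted weights -/
def wl (L : List ℕ) (μ : ℕ → ℤ) : ℕ → ℤ := fun l => μ l + L.count l - L.count (l + 1)

theorem wsh_wl (L : List ℕ) (i : ℕ) (μ : ℕ → ℤ) : wsh i (wl L μ) = wl (L ++ [i]) μ := by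
  funext l
  unfold wsh wl
  simp only [List.count_append, List.count_singleton, beq_iff_eq]
  push_cast
  simp only [eq_comm (a := i)]
  ring

theorem wl_cons (L : List ℕ) (i : ℕ) (μ : ℕ → ℤ) : wl L (wsh i μ) = wl (i :: L) μ := by
  funext l
  unfold wsh wl
  simp only [List.count_cons, beq_iff_eq]
  push_cast
  simp only [eq_comm (a := i)]
  ring

theorem phi_snoc (F : ℕ → ℕ → Module.End ℂ M) (P : ℕ → Module.End ℂ M) (L : List ℕ) (i : ℕ) :
    ∀ (μ : ℕ → ℤ) (x : M), phiList F P (L ++ [i]) μ x = PhiOp F P (wl L μ) i (phiList F P L μ x) := by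
  induction L with
  | nil =>
    intro μ x
    have : wl [] μ = μ := by funext l; simp [wl]
    rw [this]; rfl
  | cons j L ih =>
    intro μ x
    rw [List.cons_append, phiList, ih, phiList, wl_cons]

theorem InR_snoc {L : List ℕ} {i : ℕ} (h : InR n (L ++ [i])) : InR n L ∧ 1 ≤ i ∧ i ≤ n + 1 :=
  ⟨fun j hj => h j (by simp [hj]), h i (by simp)⟩

theorem InR_snoc' {L : List ℕ} {i : ℕ} (h : InR n L) (hi : 1 ≤ i ∧ i ≤ n + 1) : InR n (L ++ [i]) := by
  intro j hj
  rw [List.mem_append, List.mem_singleton] at hj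
  rcases hj with hj | rfl
  · exact h j hj
  · exact hi

theorem phi_hw (C : Ctx n σ lam v) (L : List ℕ) (hL : InR n L) :
    IsHWvec n (Hr n σ) (Er n σ) (wl L (lam0 lam)) (phiList (Fr n σ) (Pr n σ) L (lam0 lam) v) := by
  induction L using List.reverseRecOn with
  | nil =>
    have : wl [] (lam0 lam) = lam0 lam := by funext l; simp [wl]
    rw [this]
    exact ⟨fun l h1 h2 => C.hv.1 (l + 1) (by omega) (by omega),
      fun p q h1 h2 h3 => C.hv.2 (p + 1) (q + 1) (by omega) (by omega) (by omega)⟩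
  | append_singleton L i ih =>
    obtain ⟨h1, h2, h3⟩ := InR_snoc hL
    rw [phi_snoc, ← wsh_wl]
    exact Phi_hw σ _ h2 h3 (ih h1)

/-- full weights -/
def sw (lam : ℕ → ℕ) (L : List ℕ) (l : ℕ) : ℤ := lam l - (L.map (pair l 1)).sum

theorem phi_sw (C : Ctx n σ lam v) (L : List ℕ) (hL : InR n L) {l : ℕ} (hl : 1 ≤ l)
    (hln : l ≤ n + 1) :
    σ.H l (phiList (Fr n σ) (Pr n σ) L (lam0 lam) v) =
      ((sw lam L l : ℤ) : ℂ) • phiList (Fr n σ) (Pr n σ) L (lam0 lam) v := by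
  induction L using List.reverseRecOn with
  | nil =>
    have := C.hv.1 l hl hln
    simpa [sw, phiList] using this
  | append_singleton L i ih =>
    obtain ⟨h1, h2, h3⟩ := InR_snoc hL
    rw [phi_snoc, Phi_wt σ _ h2 h3 hl hln (ih h1)]
    congr 2
    unfold sw; simp; ring

theorem pl_sw (C : Ctx n σ lam v) (L : List ℕ) (hL : InR n L) {l : ℕ} (hl : 1 ≤ l)
    (hln : l ≤ n + 1) :
    σ.H l (pl n σ L v) = ((sw lam L l : ℤ) : ℂ) • pl n σ L v := by
  induction L using List.reverseRecOn with
  | nil =>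
    have := C.hv.1 l hl hln
    simpa [sw, pl] using this
  | append_singleton L i ih =>
    obtain ⟨h1, h2, h3⟩ := InR_snoc hL
    rw [pl_snoc, Pr, HF1 σ hl hln le_rfl h2 h3, ih h1, map_smul, ← sub_smul]
    congr 1
    rw [← Int.cast_sub]
    congr 1
    unfold sw; simp; ring

theorem sw_count (L : List ℕ) {l : ℕ} (hl : 1 ≤ l) :
    sw lam L l = lam l - ((if l = 1 then (L.length : ℤ) else 0) + L.count l - L.count (l - 1)) := by
  unfold sw
  congr 1
  induction L with
  | nil => simp
  | cons i L ih =>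
    rw [List.map_cons, List.sum_cons, ih]
    simp only [List.count_cons, List.length_cons, beq_iff_eq]
    unfold pair
    push_cast
    split_ifs <;> omega

theorem len_count (L : List ℕ) (hL : InR n L) :
    L.length = ∑ i ∈ Finset.Icc 1 (n + 1), L.count i := by
  induction L with
  | nil => simp
  | cons j L ih =>
    have hj := hL j (by simp)
    rw [List.length_cons, ih fun i hi => hL i (by simp [hi])]
    simp only [List.count_cons, Finset.sum_add_distrib, beq_iff_eq]
    rw [Finset.sum_ite_eq, if_pos (Finset.mem_Icc.2 hj)]

theorem count_zero (L : List ℕ) (hL : InR n L) {i : ℕ} (hi : ¬ (1 ≤ i ∧ i ≤ n + 1)) :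
    L.count i = 0 := List.count_eq_zero.2 fun h => hi (hL i h)

theorem perm_of_sw {L L' : List ℕ} (hL : InR n L) (hL' : InR n L')
    (h : ∀ l, 1 ≤ l → l ≤ n + 1 → sw lam L l = sw lam L' l) : L.Perm L' := by
  have h1 : (L.count 1 : ℤ) - L'.count 1 = L'.length - L.length := by
    have := h 1 le_rfl (by omega)
    rw [sw_count _ le_rfl, sw_count _ le_rfl] at this
    simp only [if_true, Nat.sub_self, count_zero L hL (i := 0) (by omega),
      count_zero L' hL' (i := 0) (by omega)] at this
    omega
  have h2 : ∀ l, 1 ≤ l → l ≤ n + 1 → (L.count l : ℤ) - L'.count l = L'.length - L.length := by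
    intro l hl
    induction l, hl using Nat.le_induction with
    | base => intro _; exact h1
    | succ l hl ih =>
      intro hln
      have := h (l + 1) (by omega) hln
      rw [sw_count _ (by omega), sw_count _ (by omega), if_neg (by omega), if_neg (by omega)] at this
      have := ih (by omega)
      simp only [Nat.add_sub_cancel] at *
      omega
  have h3 : (L.length : ℤ) - L'.length = (n + 1) * (L'.length - L.length) := by
    rw [len_count L hL, len_count L' hL'] 
    push_cast
    rw [← Finset.sum_sub_distrib, Finset.sum_congr rfl (fun l hl => h2 l (Finset.mem_Icc.1 hl).1
      (Finset.mem_Icc.1 hl).2), Finset.sum_const, len_count L hL, len_count L' hL']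
    simp
  have h4 : (L'.length : ℤ) - L.length = 0 := by
    have : ((n : ℤ) + 2) * (L'.length - L.length) = 0 := by linarith
    rcases mul_eq_zero.1 this with h | h
    · omega
    · exact h
  rw [List.perm_iff_count]
  intro l
  by_cases hl : 1 ≤ l ∧ l ≤ n + 1
  · have := h2 l hl.1 hl.2
    omega
  · rw [count_zero L hL hl, count_zero L' hL' hl]

theorem sw_perm {L L' : List ℕ} (h : L.Perm L') (l : ℕ) : sw lam L l = sw lam L' l := by
  unfold sw
  rw [(h.map _).sum_eq]

end PartF
end Paper


namespace Paper
section PartG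

variable {M : Type} [AddCommGroup M] [Module ℂ M]
variable {n : ℕ} {σ : SLRep (n + 1) M} {lam : ℕ → ℕ} {v : M}

theorem Qop_mem (F : ℕ → ℕ → Module.End ℂ M) (μ : ℕ → ℤ) (s : ℕ) (S : Submodule ℂ M)
    (hS : ∀ p q, 1 ≤ p → p ≤ q → q ≤ s → ∀ x ∈ S, F p q x ∈ S) :
    ∀ d k : ℕ, s + 1 - k = d → 1 ≤ k → k ≤ s + 1 → ∀ x ∈ S, Qop F μ s k x ∈ S := by
  intro d
  induction d using Nat.strong_induction_on with
  | _ d ih =>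
    intro k hd hk hks x hx
    rcases Nat.lt_or_ge s k with h | h
    · obtain rfl : k = s + 1 := by omega
      rw [Qop_top]; exact hx
    · rw [Qop_app _ _ h]
      refine S.sum_mem fun j hj => S.smul_mem _ ?_
      rw [Finset.mem_Icc] at hj
      exact ih (s + 1 - (j + 1)) (by omega) (j + 1) rfl (by omega) (by omega) _
        (hS k j hk hj.1 hj.2 x hx)

theorem Qop_nM (F : ℕ → ℕ → Module.End ℂ M) (μ : ℕ → ℤ) {s k : ℕ} (hk : 1 ≤ k) (hks : k ≤ s) (x : M) :
    Qop F μ s k x ∈ nM s F := by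
  rw [Qop_app _ _ hks]
  refine Submodule.sum_mem _ fun j hj => Submodule.smul_mem _ _ ?_
  rw [Finset.mem_Icc] at hj
  refine Qop_mem F μ s (nM s F) (fun p q h1 h2 h3 x _ => mem_nM h1 h2 h3 x) _ (j + 1) rfl
    (by omega) (by omega) _ (mem_nM hk hj.1 hj.2 x)

theorem nM_mono {F : ℕ → ℕ → Module.End ℂ M} {s s' : ℕ} (h : s ≤ s') : nM s F ≤ nM s' F := by
  apply Submodule.span_mono
  rintro y ⟨p, q, x, h1, h2, h3, rfl⟩
  exact ⟨p, q, x, h1, h2, by omega, rfl⟩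

theorem mus_sum (μ : ℕ → ℤ) (L : List ℕ) (m s : ℕ) (h : m ≤ s) :
    mus (wl L μ) m s = mus μ m s - (L.count m - L.count (s + 1)) := by
  induction s, h using Nat.le_induction with
  | base => simp [mus, wl]; ring
  | succ s hs ih =>
    have e : ∀ μ : ℕ → ℤ, mus μ m (s + 1) = mus μ m s - (μ (s + 1) + 1) := by
      intro μ
      unfold mus
      rw [Finset.sum_Icc_succ_top (by omega)]; ring
    rw [e, e, ih]; simp only [wl]; ring

theorem mus_neg (L : List ℕ) {m i : ℕ} (hm : m + 1 ≤ i) (hc : L.count i ≤ lam i) :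
    mus (wl L (lam0 lam)) m (i - 1) < 0 := by
  rw [mus_sum _ _ _ _ (by omega), show i - 1 + 1 = i by omega]
  have : mus (lam0 lam) m (i - 1) ≤ - (lam i + 1) := by
    unfold mus
    rw [neg_le_neg_iff]
    have := Finset.single_le_sum (f := fun j => lam0 lam j + 1) (s := Finset.Icc m (i - 1))
      (fun j _ => by unfold lam0; omega) (Finset.mem_Icc.2 ⟨(by omega : m ≤ i - 1), le_rfl⟩)
    refine le_trans ?_ this
    simp only [lam0]
    rw [show i - 1 + 1 = i by omega]
  omega

theorem bco_ne (L : List ℕ) {i : ℕ} (hc : L.count i ≤ lam i) :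
    bco (wl L (lam0 lam)) (i - 1) 0 (i - 1) ≠ 0 := by
  unfold bco
  rw [Int.cast_ne_zero, Finset.prod_ne_zero_iff]
  intro m hm
  rw [Finset.mem_Icc] at hm
  exact (mus_neg L (by omega) hc).ne

theorem Phi_split (F : ℕ → ℕ → Module.End ℂ M) (P : ℕ → Module.End ℂ M)
    (μ : ℕ → ℤ) {i : ℕ} (hi : 1 ≤ i) (x : M) :
    PhiOp F P μ i x = bco μ (i - 1) 0 (i - 1) • P i x + 
      ∑ k ∈ Finset.Icc 1 (i - 1), bco μ (i - 1) 0 (k - 1) • Qop F μ (i - 1) k (P k x) := by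
  rw [PhiOp_app _ _ _ hi]
  obtain ⟨i, rfl⟩ : ∃ j, i = j + 1 := ⟨i - 1, by omega⟩
  rw [Finset.sum_Icc_succ_top (by omega), Nat.add_sub_cancel, Qop_top, add_comm]; rfl

/-- sorted, in range, bounded multiplicities -/
def Box (n : ℕ) (lam : ℕ → ℕ) (L : List ℕ) : Prop :=
  InR n L ∧ L.Pairwise (· ≤ ·) ∧ ∀ j, 1 ≤ j → j ≤ n + 1 → L.count j ≤ lam j

theorem Box_snoc {L : List ℕ} {i : ℕ} (h : Box n lam (L ++ [i])) :
    Box n lam L ∧ (1 ≤ i ∧ i ≤ n + 1) ∧ (∀ j ∈ L, j ≤ i) := by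
  obtain ⟨h1, h2, h3⟩ := h
  rw [List.pairwise_append] at h2
  refine ⟨⟨(InR_snoc h1).1, h2.1, fun j a b => ?_⟩, (InR_snoc h1).2, fun j hj => h2.2.2 j hj i (by simp)⟩
  have := h3 j a b
  rw [List.count_append] at this
  omega

theorem P_nM {i : ℕ} (hi : 1 ≤ i ∧ i ≤ n + 1) {z : M} (hz : z ∈ nM (i - 1) (Fr n σ)) :
    Pr n σ i z ∈ nM (i - 1) (Fr n σ) := by
  have : nM (i - 1) (Fr n σ) ≤ (nM (i - 1) (Fr n σ)).comap (Pr n σ i) := by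
    apply Submodule.span_le.2
    rintro _ ⟨p, q, x, h1, h2, h3, rfl⟩
    have := FP (σ := σ) h1 h2 (by omega) hi x
    rw [if_neg (by omega), add_zero] at this
    change Pr n σ i (Fr n σ p q x) ∈ nM (i - 1) (Fr n σ)
    rw [← this]
    exact mem_nM h1 h2 h3 _
  exact this hz

theorem phi_congr (L : List ℕ) (hL : Box n lam L) :
    ∀ m, (∀ j ∈ L, j ≤ m + 1) → ∃ c : ℂ, c ≠ 0 ∧
      phiList (Fr n σ) (Pr n σ) L (lam0 lam) v - c • pl n σ L v ∈ nM m (Fr n σ) := by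
  induction L using List.reverseRecOn with
  | nil =>
    intro m _
    refine ⟨1, one_ne_zero, ?_⟩
    simp [phiList, pl]
  | append_singleton L i ih =>
    intro m hm
    obtain ⟨h1, h2, h3⟩ := Box_snoc hL
    obtain ⟨c, hc, hz⟩ := ih h1 (i - 1) (fun j hj => by have := h3 j hj; omega)
    set u := phiList (Fr n σ) (Pr n σ) L (lam0 lam) v with hu
    have hb := bco_ne (lam := lam) L (i := i) (h1.2.2 i h2.1 h2.2)
    refine ⟨bco (wl L (lam0 lam)) (i - 1) 0 (i - 1) * c, mul_ne_zero hb hc, ?_⟩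
    refine nM_mono (s := i - 1) (by have := hm i (by simp); omega) ?_
    rw [phi_snoc, ← hu, Phi_split _ _ _ h2.1, pl_snoc, add_comm, add_sub_assoc, mul_smul, ← smul_sub,
      ← map_smul, ← map_sub]
    refine Submodule.add_mem _ (Submodule.sum_mem _ fun k hk => Submodule.smul_mem _ _ ?_)
      (Submodule.smul_mem _ _ (P_nM h2 hz))
    rw [Finset.mem_Icc] at hk
    exact Qop_nM _ _ hk.1 hk.2 _

theorem theta_ne (C : Ctx n σ lam v) (L : List ℕ) (hL : Box n lam L) :
    C.θ (fun j => L.count j) (pl n σ L v) ≠ 0 := by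
  induction L using List.reverseRecOn with
  | nil => exact C.θv
  | append_singleton L i ih =>
    obtain ⟨h1, h2, h3⟩ := Box_snoc hL
    rw [pl_snoc, C.θP _ (fun j => L.count j) i h2.1 h2.2]
    · refine mul_ne_zero ?_ (ih h1)
      rw [Nat.cast_ne_zero]
      simp
    · intro j hj
      rw [List.count_eq_zero]
      intro h
      rw [List.mem_append, List.mem_singleton] at h
      rcases h with h | h
      · have := h3 j h; omega
      · omega
    · exact hL.2.2 i h2.1 h2.2
    · simp
    · intro j hj
      simp [List.count_append, Ne.symm hj]

theorem theta_nM (C : Ctx n σ lam v) (K : ℕ → ℕ) {y : M} (hy : y ∈ nM n (Fr n σ)) : C.θ K y = 0 := by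
  have : nM n (Fr n σ) ≤ LinearMap.ker (C.θ K) := by
    apply Submodule.span_le.2
    rintro _ ⟨p, q, x, h1, h2, h3, rfl⟩
    exact C.θF K p q h1 h2 h3 x
  exact this hy

theorem phi_ne (C : Ctx n σ lam v) (L : List ℕ) (hL : Box n lam L) :
    phiList (Fr n σ) (Pr n σ) L (lam0 lam) v ≠ 0 := by
  intro h
  obtain ⟨c, hc, hz⟩ := phi_congr (σ := σ) (v := v) L hL n fun j hj => (hL.1 j hj).2
  have := theta_nM C (fun j => L.count j) hz
  rw [h, zero_sub, map_neg, map_smul, neg_eq_zero, smul_eq_mul] at this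
  exact mul_ne_zero hc (theta_ne C L hL) this

theorem fP_pow {i : ℕ} (hi : 2 ≤ i) (hin : i ≤ n + 1) (a : ℕ) (x : M) :
    σ.F i i ((Pr n σ (i - 1) ^ (a + 1)) x) = (Pr n σ (i - 1) ^ (a + 1)) (σ.F i i x) +
      ((a : ℂ) + 1) • Pr n σ i ((Pr n σ (i - 1) ^ a) x) := by
  have key : ∀ x, σ.F i i (Pr n σ (i - 1) x) = Pr n σ (i - 1) (σ.F i i x) + Pr n σ i x := by
    intro x
    have := FP (σ := σ) (p := i - 1) (q := i - 1) (j := i - 1) (by omega) le_rfl (by omega)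
      ⟨by omega, by omega⟩ x
    rw [if_pos rfl, Fr, show i - 1 + 1 = i by omega] at this
    exact this
  induction a with
  | zero => simp [key]
  | succ a ih =>
    rw [pow_succ', Module.End.mul_apply, key, ih, map_add, map_smul,
      P_comm (i := i - 1) (j := i) ⟨by omega, by omega⟩ ⟨by omega, by omega⟩, ← Module.End.mul_apply,
      ← Module.End.mul_apply (Pr n σ (i - 1)), ← pow_succ', ← pow_succ', add_assoc]
    congr 1
    push_cast
    rw [add_smul ((a : ℂ) + 1), one_smul]

theorem vanish_aux {i : ℕ} (hi : 2 ≤ i) (hin : i ≤ n + 1) (b : ℕ) :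
    ∀ (a : ℕ) (y : M) (A : Module.End ℂ M), (σ.F i i ^ b) y = 0 →
      (∀ x, A (σ.F i i x) = σ.F i i (A x)) →
      A ((Pr n σ i ^ b) ((Pr n σ (i - 1) ^ a) y)) ∈ nM n (Fr n σ) := by
  induction b with
  | zero =>
    intro a y A hy _
    have : y = 0 := by simpa using hy
    rw [this]; simp
  | succ b ih =>
    intro a y A hy hA
    have hPf : ∀ x, Pr n σ i (σ.F i i x) = σ.F i i (Pr n σ i x) := by
      intro x
      have := FP (σ := σ) (p := i - 1) (q := i - 1) (j := i) (by omega) le_rfl (by omega)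
        ⟨by omega, by omega⟩ x
      rw [if_neg (by omega), Fr, show i - 1 + 1 = i by omega, add_zero] at this
      exact this.symm
    have hPf' : ∀ (k : ℕ) x, (Pr n σ i ^ k) (σ.F i i x) = σ.F i i ((Pr n σ i ^ k) x) := by
      intro k
      induction k with
      | zero => intro x; rfl
      | succ k ih => intro x; rw [pow_succ', Module.End.mul_apply, ih, hPf, Module.End.mul_apply]
    have h0 : ((a : ℂ) + 1) ≠ 0 := by exact_mod_cast Nat.succ_ne_zero a
    have e : Pr n σ i ((Pr n σ (i - 1) ^ a) y) = ((a : ℂ) + 1)⁻¹ •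
        (σ.F i i ((Pr n σ (i - 1) ^ (a + 1)) y) - (Pr n σ (i - 1) ^ (a + 1)) (σ.F i i y)) := by
      rw [fP_pow hi hin, add_sub_cancel_left, smul_smul, inv_mul_cancel₀ h0, one_smul]
    rw [pow_succ, Module.End.mul_apply, e, map_smul, map_smul, map_sub, map_sub]
    refine Submodule.smul_mem _ _ (Submodule.sub_mem _ ?_ ?_)
    · rw [hPf', hA]
      have := mem_nM (F := Fr n σ) (N := n) (p := i - 1) (q := i - 1) (by omega) le_rfl (by omega)
        (A ((Pr n σ i ^ b) ((Pr n σ (i - 1) ^ (a + 1)) y)))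
      rw [Fr, show i - 1 + 1 = i by omega] at this
      exact this
    · apply ih (a + 1) (σ.F i i y) A _ hA
      rw [← Module.End.mul_apply, ← pow_succ]; exact hy

theorem pl_append (L L' : List ℕ) (x : M) : pl n σ (L ++ L') x = pl n σ L' (pl n σ L x) := by
  simp [pl]

theorem pl_replicate (k i : ℕ) (x : M) : pl n σ (List.replicate k i) x = (Pr n σ i ^ k) x := by
  induction k with
  | zero => rfl
  | succ k ih =>
    rw [List.replicate_succ', pl_snoc, ih, pow_succ', Module.End.mul_apply]

/-- as endomorphism -/
theorem pl_end (L : List ℕ) : ∃ A : Module.End ℂ M, ∀ x, pl n σ L x = A x := by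
  induction L using List.reverseRecOn with
  | nil => exact ⟨1, fun x => rfl⟩
  | append_singleton L i ih =>
    obtain ⟨A, hA⟩ := ih
    exact ⟨Pr n σ i * A, fun x => by rw [pl_snoc, hA]; rfl⟩

theorem pl_F {i : ℕ} (hi : 2 ≤ i) (hin : i ≤ n + 1) (L : List ℕ) (hL : InR n L)
    (hLi : i - 1 ∉ L) (x : M) : pl n σ L (σ.F i i x) = σ.F i i (pl n σ L x) := by
  induction L using List.reverseRecOn with
  | nil => rfl
  | append_singleton L j ih =>
    obtain ⟨h1, h2⟩ := InR_snoc hL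
    rw [pl_snoc, pl_snoc, ih h1 (fun h => hLi (by simp [h]))]
    have := FP (σ := σ) (p := i - 1) (q := i - 1) (j := j) (by omega) le_rfl (by omega) h2 (pl n σ L x)
    rw [if_neg (by rintro rfl; exact hLi (by simp)), Fr, show i - 1 + 1 = i by omega, add_zero] at this
    exact this.symm

theorem vanish (C : Ctx n σ lam v) (L : List ℕ) (hL : InR n L) {i : ℕ} (hi : 1 ≤ i) (hin : i ≤ n + 1)
    (hc : lam i < L.count i) : pl n σ L v ∈ nM n (Fr n σ) := by
  rcases Nat.lt_or_ge 1 i with h | h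
  · set A := L.filter (fun j => decide (j ≠ i - 1 ∧ j ≠ i)) with hA
    have hperm : L.Perm ((List.replicate (L.count (i - 1)) (i - 1) ++ List.replicate (L.count i) i) ++ A) := by
      rw [List.perm_iff_count]
      intro j
      rw [List.count_append, List.count_append, List.count_replicate, List.count_replicate]
      by_cases h1 : j = i - 1
      · have : A.count j = 0 := by
          rw [List.count_eq_zero, hA, List.mem_filter]; simp [h1]
        rw [this, h1]
        have h2 : ¬ i = i - 1 := by omega
        simp [h2]
      · by_cases h2 : j = i
        · have : A.count j = 0 := by
            rw [List.count_eq_zero, hA, List.mem_filter]; simp [h2]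
          rw [this, h2]
          have h2 : ¬ i - 1 = i := by omega
          simp [h2]
        · rw [hA, List.count_filter (by simp [h1, h2])]
          simp [Ne.symm h1, Ne.symm h2]
    rw [pl_perm hperm hL, pl_append, pl_append, pl_replicate, pl_replicate]
    obtain ⟨T, hT⟩ := pl_end (σ := σ) A
    rw [hT]
    apply vanish_aux (by omega) hin
    · exact f_pow' C hi hin hc
    · intro x
      rw [← hT, ← hT]
      apply pl_F (by omega) hin
      · intro j hj
        exact hL j (List.mem_of_mem_filter hj)
      · rw [hA, List.mem_filter]; simp
  · obtain rfl : i = 1 := by omega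
    set A := L.filter (fun j => decide (j ≠ 1)) with hA
    have hperm : L.Perm (List.replicate (L.count 1) 1 ++ A) := by
      rw [List.perm_iff_count]
      intro j
      rw [List.count_append, List.count_replicate]
      by_cases h1 : j = 1
      · have : A.count j = 0 := by
          rw [List.count_eq_zero, hA, List.mem_filter]; simp [h1]
        rw [this, h1]
        simp
      · rw [hA, List.count_filter (by simp [h1])]
        simp [Ne.symm h1]
    rw [pl_perm hperm hL, pl_append, pl_replicate]
    obtain ⟨T, hT⟩ := pl_end (σ := σ) A
    have : (Pr n σ 1 ^ L.count 1) v = 0 := f_pow' C hi hin hc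
    rw [hT, this, map_zero]; exact Submodule.zero_mem _

/-- subspace stable under `Fr` and generated by vectors with `P`-images inside is `P` stable -/
theorem P_stable (S T : Submodule ℂ M) (hS : ∀ p q, 1 ≤ p → p ≤ q → q ≤ n → ∀ x ∈ S, Fr n σ p q x ∈ S)
    (hT : T = ⨅ i : {i : ℕ // 1 ≤ i ∧ i ≤ n + 1}, S.comap (Pr n σ i.1)) :
    ∀ p q, 1 ≤ p → p ≤ q → q ≤ n → ∀ x ∈ S ⊓ T, Fr n σ p q x ∈ S ⊓ T := by
  intro p q h1 h2 h3 x hx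
  have hx2 : ∀ i, 1 ≤ i → i ≤ n + 1 → Pr n σ i x ∈ S := by
    intro i a b
    have := hx.2
    rw [hT] at this
    exact (Submodule.mem_iInf _).1 this ⟨i, a, b⟩
  refine Submodule.mem_inf.2 ⟨hS p q h1 h2 h3 x hx.1, ?_⟩
  rw [hT, Submodule.mem_iInf]
  rintro ⟨i, a, b⟩
  rw [Submodule.mem_comap]
  have := FP (σ := σ) h1 h2 h3 ⟨a, b⟩ x
  have e : Pr n σ i (Fr n σ p q x) = Fr n σ p q (Pr n σ i x) - if p = i then Pr n σ (q + 1) x else 0 := by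
    rw [this]; simp
  simp only
  rw [e]
  refine S.sub_mem (hS p q h1 h2 h3 _ (hx2 i a b)) ?_
  split_ifs
  · exact hx2 _ (by omega) (by omega)
  · exact S.zero_mem

theorem top_of_stable (C : Ctx n σ lam v) (S : Submodule ℂ M)
    (hF : ∀ p q, 1 ≤ p → p ≤ q → q ≤ n → ∀ x ∈ S, Fr n σ p q x ∈ S)
    (hP : ∀ i, 1 ≤ i → i ≤ n + 1 → ∀ x ∈ S, Pr n σ i x ∈ S) (hv : v ∈ S) : S = ⊤ := by
  rw [eq_top_iff, ← C.hgen]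
  apply slGen_le σ C.hv S _ hv
  intro p q h1 h2 h3 x hx
  rcases Nat.lt_or_ge 1 p with h | h
  · have := hF (p - 1) (q - 1) (by omega) (by omega) (by omega) x hx
    rw [Fr, show p - 1 + 1 = p by omega, show q - 1 + 1 = q by omega] at this
    exact this
  · obtain rfl : p = 1 := by omega
    exact hP q h2 h3 x hx

theorem span_top (C : Ctx n σ lam v) :
    Submodule.span ℂ {y | ∃ L, InR n L ∧ y = pl n σ L v} ⊔ nM n (Fr n σ) = ⊤ := by
  set W : Submodule ℂ M := sInf {S | (∀ p q, 1 ≤ p → p ≤ q → q ≤ n → ∀ x ∈ S, Fr n σ p q x ∈ S) ∧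
    ∀ L, InR n L → pl n σ L v ∈ S} with hW
  have hWF : ∀ p q, 1 ≤ p → p ≤ q → q ≤ n → ∀ x ∈ W, Fr n σ p q x ∈ W := by
    intro p q h1 h2 h3 x hx
    rw [hW, Submodule.mem_sInf] at *
    exact fun S hS => hS.1 p q h1 h2 h3 x (hx S hS)
  have hWL : ∀ L, InR n L → pl n σ L v ∈ W := by
    intro L hL
    rw [hW, Submodule.mem_sInf]
    exact fun S hS => hS.2 L hL
  have hP : W ≤ W ⊓ ⨅ i : {i : ℕ // 1 ≤ i ∧ i ≤ n + 1}, W.comap (Pr n σ i.1) := by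
    apply sInf_le
    refine ⟨P_stable W _ hWF rfl, ?_⟩
    intro L hL
    refine Submodule.mem_inf.2 ⟨hWL L hL, ?_⟩
    rw [Submodule.mem_iInf]
    rintro ⟨i, hi⟩
    rw [Submodule.mem_comap, ← pl_snoc]
    exact hWL _ (InR_snoc' hL hi)
  have htop : W = ⊤ := by
    apply top_of_stable C W hWF
    · intro i h1 h2 x hx
      exact (Submodule.mem_iInf _).1 (hP hx).2 ⟨i, h1, h2⟩
    · exact hWL [] (by intro i hi; simp at hi)
  rw [eq_top_iff, ← htop]
  apply sInf_le
  refine ⟨fun p q h1 h2 h3 x _ => Submodule.mem_sup_right (mem_nM h1 h2 h3 x), fun L hL => ?_⟩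
  exact Submodule.mem_sup_left (Submodule.subset_span ⟨L, hL, rfl⟩)

theorem orth_wt (C : Ctx n σ lam v) {x y : M} {a c l : ℕ → ℤ} {i : ℕ} (h1 : 1 ≤ i) (h2 : i ≤ n + 1)
    (hx : σ.H i x = ((a i : ℤ) : ℂ) • x) (hy : σ.H i y = ((c i : ℤ) : ℂ) • y) (h : a i ≠ c i) :
    C.b.B x y = 0 := by
  have := C.aH i h1 h2 x y
  rw [hx, hy, C.b.smul_left, map_smul, smul_eq_mul, map_intCast, ← sub_eq_zero, ← sub_mul,
    mul_eq_zero, sub_eq_zero, Int.cast_inj] at this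
  exact this.resolve_left h

theorem mult0 (C : Ctx n σ lam v) {L : List ℕ} (hL : InR n L) {z : M} (hz : Kil n σ z)
    (hw : ∀ l, 1 ≤ l → l ≤ n + 1 → σ.H l z = ((sw lam L l : ℤ) : ℂ) • z)
    (h0 : C.b.B z (pl n σ L v) = 0) : z = 0 := by
  apply C.b.definite
  have : (⊤ : Submodule ℂ M) ≤ LinearMap.ker (C.b.B z) := by
    rw [← span_top C]
    apply sup_le
    · apply Submodule.span_le.2
      rintro _ ⟨L', hL', rfl⟩
      change C.b.B z _ = 0
      by_cases h : ∀ l, 1 ≤ l → l ≤ n + 1 → sw lam L' l = sw lam L l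
      · rw [pl_perm (perm_of_sw hL' hL h) hL', h0]
      · push Not at h
        obtain ⟨l, h1, h2, h3⟩ := h
        exact orth_wt C (l := 0) h1 h2 (hw l h1 h2) (pl_sw C L' hL' h1 h2) h3.symm
    · intro y hy
      exact C.kil_nM hz hy
  exact this (Submodule.mem_top (x := z))

theorem mult_zero (C : Ctx n σ lam v) {L : List ℕ} (hL : InR n L) {z : M} (hz : Kil n σ z)
    (hw : ∀ l, 1 ≤ l → l ≤ n + 1 → σ.H l z = ((sw lam L l : ℤ) : ℂ) • z)
    {i : ℕ} (h1 : 1 ≤ i) (h2 : i ≤ n + 1) (hc : lam i < L.count i) : z = 0 :=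
  mult0 C hL hz hw (C.kil_nM hz (vanish C L hL h1 h2 hc))

theorem mult_one (C : Ctx n σ lam v) {L : List ℕ} (hL : Box n lam L) {z : M} (hz : Kil n σ z)
    (hw : ∀ l, 1 ≤ l → l ≤ n + 1 → σ.H l z = ((sw lam L l : ℤ) : ℂ) • z) :
    ∃ α : ℂ, z = α • phiList (Fr n σ) (Pr n σ) L (lam0 lam) v := by
  set w := phiList (Fr n σ) (Pr n σ) L (lam0 lam) v with hwdef
  have hwk : Kil n σ w := (phi_hw C L hL.1).2
  obtain ⟨c, hc, hcz⟩ := phi_congr (σ := σ) (v := v) L hL n fun j hj => (hL.1 j hj).2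
  rw [← hwdef] at hcz
  have hne : C.b.B w (pl n σ L v) ≠ 0 := by
    intro h
    have h1 := C.kil_nM hwk hcz
    rw [map_sub, map_smul, h, smul_zero, sub_zero] at h1
    exact phi_ne C L hL (C.b.definite _ h1)
  set α : ℂ := (starRingEnd ℂ) (C.b.B z (pl n σ L v) / C.b.B w (pl n σ L v)) with hα
  refine ⟨α, sub_eq_zero.1 (mult0 C hL.1 ?_ ?_ ?_)⟩
  · intro p q h1 h2 h3
    rw [map_sub, map_smul, hz p q h1 h2 h3, hwk p q h1 h2 h3, smul_zero, sub_zero]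
  · intro l h1 h2
    rw [map_sub, map_smul, hw l h1 h2, phi_sw C L hL.1 h1 h2, smul_sub, smul_comm]
  · rw [C.b.sub_left, C.b.smul_left, hα, Complex.conj_conj, div_mul_cancel₀ _ hne, sub_self]

end PartG
end Paper


namespace Paper
section PartH

theorem count_expList (l : List ℕ) : ∀ j t, (expList l j).count t = if j ≤ t then l.getD (t - j) 0 else 0 := by
  induction l with
  | nil => intro j t; simp [expList]
  | cons m l ih =>
    intro j t
    rw [expList, List.count_append, ih, List.count_replicate]
    rcases Nat.lt_trichotomy j t with h | h | h
    · obtain ⟨d, rfl⟩ : ∃ d, t = j + 1 + d := ⟨t - (j + 1), by omega⟩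
      have e : j + 1 + d - j = d + 1 := by omega
      have e2 : (j == j + 1 + d) = false := by simp; omega
      rw [e, e2]
      simp [show j ≤ j + 1 + d by omega]
    · subst h; simp
    · have e2 : (j == t) = false := by simp; omega
      rw [e2, if_neg (show ¬ j + 1 ≤ t by omega), if_neg (show ¬ j ≤ t by omega)]; simp

theorem mem_expList (l : List ℕ) : ∀ j, ∀ t ∈ expList l j, j ≤ t ∧ t < j + l.length := by
  induction l with
  | nil => intro j t; simp [expList]
  | cons m l ih =>
    intro j t ht
    rw [expList, List.mem_append, List.mem_replicate] at ht
    rw [List.length_cons]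
    rcases ht with ht | ht
    · omega
    · have := ih _ _ ht; omega

theorem sorted_expList (l : List ℕ) : ∀ j, (expList l j).Pairwise (· ≤ ·) := by
  induction l with
  | nil => intro j; simp [expList]
  | cons m l ih =>
    intro j
    rw [expList, List.pairwise_append]
    refine ⟨List.pairwise_replicate.2 (Or.inr le_rfl), ih _, ?_⟩
    intro a ha b hb
    have := mem_expList l _ b hb
    have := (List.mem_replicate.1 ha).2
    omega

theorem evec_spec (m : ℕ) (iv : ℕ → ℕ) : ∀ L, L = (List.range m).flatMap (fun t => List.replicate (iv (t + 1)) (t + 1)) →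
    (∀ t ∈ L, 1 ≤ t ∧ t ≤ m) ∧ L.Pairwise (· ≤ ·) ∧
    ∀ t, L.count t = if 1 ≤ t ∧ t ≤ m then iv t else 0 := by
  induction m with
  | zero => rintro _ rfl; simp; omega
  | succ m ih =>
    rintro _ rfl
    rw [List.range_succ, List.flatMap_append, List.flatMap_singleton]
    obtain ⟨h1, h2, h3⟩ := ih _ rfl
    refine ⟨?_, ?_, ?_⟩
    · intro t ht
      rw [List.mem_append, List.mem_replicate] at ht
      rcases ht with ht | ht
      · have := h1 t ht; omega
      · omega
    · rw [List.pairwise_append]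
      refine ⟨h2, List.pairwise_replicate.2 (Or.inr le_rfl), ?_⟩
      intro a ha b hb
      have := h1 a ha
      have := (List.mem_replicate.1 hb).2
      omega
    · intro t
      rw [List.count_append, h3, List.count_replicate]
      by_cases h : t = m + 1
      · subst h; simp
      · have e2 : (m + 1 == t) = false := by simp; omega
        rw [e2]
        have : (1 ≤ t ∧ t ≤ m + 1) ↔ (1 ≤ t ∧ t ≤ m) := by omega
        simp only [this]; simp

variable {M : Type} [AddCommGroup M] [Module ℂ M]
variable {n : ℕ} {σ : SLRep (n + 1) M} {lam : ℕ → ℕ} {v : M}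

/-- the list attached to an exponent tuple -/
def eL (n : ℕ) (k : Fin (n + 1) → ℕ) : List ℕ := expList (List.ofFn k) 1

theorem eL_InR (k : Fin (n + 1) → ℕ) : InR n (eL n k) := by
  intro i hi
  have := mem_expList _ _ i hi
  rw [List.length_ofFn] at this
  omega

theorem eL_count (k : Fin (n + 1) → ℕ) (l : Fin (n + 1)) : (eL n k).count (l.1 + 1) = k l := by
  rw [eL, count_expList, if_pos (by omega), Nat.add_sub_cancel]
  rw [List.getD_eq_getElem _ _ (by rw [List.length_ofFn]; exact l.2), List.getElem_ofFn]

theorem eL_ke (k : Fin (n + 1) → ℕ) (t : ℕ) : (((eL n k).count t : ℕ) : ℤ) = keFun n k t := by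
  unfold keFun
  split_ifs with h
  · have := eL_count k ⟨t - 1, by omega⟩
    rw [← this]
    simp only
    rw [Nat.sub_add_cancel h.1]
  · rw [count_zero _ (eL_InR k) h]; rfl

theorem eL_nu (k : Fin (n + 1) → ℕ) : nuW n lam k = wl (eL n k) (lam0 lam) := by
  funext l
  unfold nuW wl
  rw [eL_ke, eL_ke]

theorem eL_box (kk : expType n lam) : Box n lam (eL n kk.1) := by
  refine ⟨eL_InR _, sorted_expList _ _, fun j h1 h2 => ?_⟩
  have := eL_count kk.1 ⟨j - 1, by omega⟩
  simp only at this
  rw [Nat.sub_add_cancel h1] at this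
  rw [this]
  have := kk.2 ⟨j - 1, by omega⟩
  simp only at this
  rwa [Nat.sub_add_cancel h1] at this

theorem eL_perm {L : List ℕ} (hL : InR n L) (k : Fin (n + 1) → ℕ)
    (h : ∀ l : Fin (n + 1), k l = L.count (l.1 + 1)) : L.Perm (eL n k) := by
  rw [List.perm_iff_count]
  intro a
  by_cases ha : 1 ≤ a ∧ a ≤ n + 1
  · have := eL_count k ⟨a - 1, by omega⟩
    rw [h] at this
    simp only at this
    rw [Nat.sub_add_cancel ha.1] at this
    exact this.symm
  · rw [count_zero _ hL ha, count_zero _ (eL_InR k) ha]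

theorem jmin_ok (C : Ctx n σ lam v) (k : ℕ) (iv : ℕ → ℕ) (h1 : 1 ≤ k) (h2 : k ≤ n + 1)
    (h : ∀ h, 1 ≤ h → h ≤ k - 1 → iv h ≤ lam h) :
    Jmin (Fr n σ) (Pr n σ) (lam0 lam) v k iv (lam k + 1) := by
  obtain ⟨a1, a2, a3⟩ := evec_spec (k - 1) iv (evec k iv) rfl
  have hI : ∀ J, InR n (evec k iv ++ List.replicate J k) := by
    intro J t ht
    rw [List.mem_append, List.mem_replicate] at ht
    rcases ht with ht | ht
    · have := a1 t ht; omega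
    · omega
  refine ⟨by omega, ?_, ?_⟩
  · refine mult_zero C (hI (lam k + 1)) (phi_hw C _ (hI _)).2
      (fun l b1 b2 => phi_sw C _ (hI _) b1 b2) h1 h2 ?_
    rw [List.count_append, List.count_replicate]
    simp; omega
  · intro J _ hJ
    refine phi_ne C _ ⟨hI J, ?_, ?_⟩
    · rw [List.pairwise_append]
      refine ⟨a2, List.pairwise_replicate.2 (Or.inr le_rfl), ?_⟩
      intro a ha b hb
      have := a1 a ha
      have := (List.mem_replicate.1 hb).2
      omega
    · intro j b1 b2
      rw [List.count_append, a3, List.count_replicate]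
      by_cases hjk : j = k
      · subst hjk
        rw [if_neg (by omega)]; simp; omega
      · have e2 : (k == j) = false := by simp; omega
        rw [e2, if_neg Bool.false_ne_true, add_zero]
        split_ifs with hc
        · exact h j hc.1 hc.2
        · exact Nat.zero_le _

/-- the summand -/
noncomputable abbrev NN (n : ℕ) (σ : SLRep (n + 1) M) (lam : ℕ → ℕ) (v : M) (kk : expType n lam) : Submodule ℂ M :=
  slGen n (Hr n σ) (Er n σ) (Fr n σ) (wVec n σ lam v kk.1)

theorem w_hw (C : Ctx n σ lam v) (kk : expType n lam) :
    IsHWvec n (Hr n σ) (Er n σ) (nuW n lam kk.1) (wVec n σ lam v kk.1) := by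
  rw [eL_nu]; exact phi_hw C _ (eL_InR _)

theorem memS (C : Ctx n σ lam v) {L : List ℕ} (hL : InR n L) {z : M} (hz : Kil n σ z)
    (hw : ∀ l, 1 ≤ l → l ≤ n + 1 → σ.H l z = ((sw lam L l : ℤ) : ℂ) • z) :
    z ∈ ⨆ kk, NN n σ lam v kk := by
  by_cases h : ∀ l : Fin (n + 1), L.count (l.1 + 1) ≤ lam (l.1 + 1)
  · let kk : expType n lam := ⟨fun l => L.count (l.1 + 1), h⟩
    have hp : L.Perm (eL n kk.1) := eL_perm hL kk.1 fun l => rfl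
    obtain ⟨α, hα⟩ := mult_one C (eL_box kk) hz (fun l a b => by
      rw [← sw_perm hp]; exact hw l a b)
    rw [hα]
    exact Submodule.smul_mem _ _ (Submodule.mem_iSup_of_mem kk (slGen_self _ _ _ _ _))
  · push Not at h
    obtain ⟨l, hl⟩ := h
    rw [mult_zero C hL hz hw (by omega) (by omega) hl]
    exact zero_mem _

theorem S_stable : ∀ p q, 1 ≤ p → p ≤ q → q ≤ n → ∀ x ∈ ⨆ kk, NN n σ lam v kk,
    Fr n σ p q x ∈ ⨆ kk, NN n σ lam v kk := by
  intro p q h1 h2 h3 x hx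
  have : (⨆ kk, NN n σ lam v kk) ≤ (⨆ kk, NN n σ lam v kk).comap (Fr n σ p q) := by
    refine iSup_le fun kk y hy => ?_
    exact Submodule.mem_iSup_of_mem kk (((slGen_inv n _ _ _ _).2 p q h1 h2 h3 y hy).2)
  exact this hx

theorem P_w (C : Ctx n σ lam v) (kk : expType n lam) : ∀ i, 1 ≤ i → i ≤ n + 1 →
    Pr n σ i (wVec n σ lam v kk.1) ∈ ⨆ kk, NN n σ lam v kk := by
  intro i
  induction i using Nat.strong_induction_on with
  | _ i ih =>
    intro h1 h2
    set S := ⨆ kk, NN n σ lam v kk with hS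
    have hB := eL_box kk
    have hI : InR n (eL n kk.1 ++ [i]) := by
      intro t ht
      rw [List.mem_append, List.mem_singleton] at ht
      rcases ht with ht | rfl
      · exact hB.1 t ht
      · omega
    have h3 := memS C hI (phi_hw C _ hI).2 (fun l b1 b2 => phi_sw C _ hI b1 b2)
    rw [phi_snoc, Phi_split _ _ _ h1, ← hS] at h3
    have h4 : ∑ k ∈ Finset.Icc 1 (i - 1), bco (wl (eL n kk.1) (lam0 lam)) (i - 1) 0 (k - 1) •
        Qop (Fr n σ) (wl (eL n kk.1) (lam0 lam)) (i - 1) k (Pr n σ k (wVec n σ lam v kk.1)) ∈ S := by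
      refine S.sum_mem fun k hk => S.smul_mem _ ?_
      rw [Finset.mem_Icc] at hk
      exact Qop_mem _ _ _ S (fun p q a b c => S_stable p q a b (by omega)) _ k rfl hk.1 (by omega) _
        (ih k (by omega) hk.1 (by omega))
    have h5 := (Submodule.add_mem_iff_left S h4).1 h3
    exact (Submodule.smul_mem_iff S (bco_ne _ (hB.2.2 i h1 h2))).1 h5

theorem S_top (C : Ctx n σ lam v) : (⨆ kk, NN n σ lam v kk) = ⊤ := by
  set S := ⨆ kk, NN n σ lam v kk with hS
  have hF := S_stable (n := n) (σ := σ) (lam := lam) (v := v)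
  rw [← hS] at hF
  set T := ⨅ i : {i : ℕ // 1 ≤ i ∧ i ≤ n + 1}, S.comap (Pr n σ i.1) with hT
  have hST : S ≤ S ⊓ T := by
    conv_lhs => rw [hS]
    refine iSup_le fun kk => ?_
    refine slGen_le (res n σ) (w_hw C kk) _ (P_stable S T hF hT) ⟨?_, ?_⟩
    · exact Submodule.mem_iSup_of_mem kk (slGen_self _ _ _ _ _)
    · rw [hT, SetLike.mem_coe, Submodule.mem_iInf]
      rintro ⟨i, a, b⟩
      exact P_w C kk i a b
  apply top_of_stable C S hF
  · intro i a b x hx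
    have := (hST hx).2
    rw [hT, SetLike.mem_coe, Submodule.mem_iInf] at this
    exact this ⟨i, a, b⟩
  · have hI : InR n [] := by intro t ht; simp at ht
    exact memS C hI (phi_hw C _ hI).2 (fun l b1 b2 => phi_sw C _ hI b1 b2)

theorem Ctx.aFr (C : Ctx n σ lam v) : ∀ p q, 1 ≤ p → p ≤ q → q ≤ n → ∀ x y,
    C.b.B (Fr n σ p q x) y = C.b.B x (Er n σ p q y) :=
  fun p q h1 h2 h3 x y => C.aF (p + 1) (q + 1) (by omega) (by omega) (by omega) x y

/-- left orthogonal -/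
def lperp (b : PForm M) (S : Submodule ℂ M) : Submodule ℂ M where
  carrier := {x | ∀ y ∈ S, b.B x y = 0}
  add_mem' := by
    intro x y hx hy z hz
    rw [b.add_left, hx z hz, hy z hz, add_zero]
  zero_mem' := fun z _ => b.zero_left z
  smul_mem' := by
    intro c x hx z hz
    rw [b.smul_left, hx z hz, mul_zero]

theorem lperp_inv (C : Ctx n σ lam v) {S : Submodule ℂ M}
    (hS : slInvariant n (Hr n σ) (Er n σ) (Fr n σ) S) :
    slInvariant n (Hr n σ) (Er n σ) (Fr n σ) (lperp C.b S) := by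
  constructor
  · intro i h1 h2 x hx y hy
    have := C.aH (i + 1) (by omega) (by omega) x y
    exact this.trans (hx _ (hS.1 i h1 h2 y hy))
  · intro p q h1 h2 h3 x hx
    constructor
    · intro y hy
      rw [C.aEr p q h1 h2 h3]
      exact hx _ ((hS.2 p q h1 h2 h3 y hy).2)
    · intro y hy
      rw [C.aFr p q h1 h2 h3]
      exact hx _ ((hS.2 p q h1 h2 h3 y hy).1)

theorem w_perp (C : Ctx n σ lam v) {k j : expType n lam} (h : k ≠ j) :
    NN n σ lam v k ≤ lperp C.b (NN n σ lam v j) := by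
  refine slGen_min (lperp_inv C (slGen_inv _ _ _ _ _)) ?_
  intro y hy
  have hy2 := slGen_le_nM (res n σ) (w_hw C j) hy
  have hk : Kil n σ (wVec n σ lam v k.1) := (w_hw C k).2
  obtain ⟨a, ha, c, hc, rfl⟩ := Submodule.mem_sup.1 hy2
  obtain ⟨α, rfl⟩ := Submodule.mem_span_singleton.1 ha
  rw [map_add, C.kil_nM hk hc, map_smul, add_zero]
  have : ∃ l, 1 ≤ l ∧ l ≤ n + 1 ∧ sw lam (eL n k.1) l ≠ sw lam (eL n j.1) l := by
    by_contra! hcon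
    apply h
    have hp := perm_of_sw (eL_InR k.1) (eL_InR j.1) hcon
    apply Subtype.ext
    funext l
    rw [← eL_count k.1 l, ← eL_count j.1 l, hp.count_eq]
  obtain ⟨l, h1, h2, h3⟩ := this
  have := orth_wt C (a := sw lam (eL n k.1)) (c := sw lam (eL n j.1)) (l := 0) h1 h2
    (phi_sw C _ (eL_InR k.1) h1 h2) (phi_sw C _ (eL_InR j.1) h1 h2) h3
  rw [show C.b.B (wVec n σ lam v k.1) (wVec n σ lam v j.1) = 0 from this, smul_zero]

theorem NN_indep (C : Ctx n σ lam v) : iSupIndep (NN n σ lam v) := by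
  intro k
  rw [Submodule.disjoint_def]
  intro x hx hx2
  apply C.b.definite
  have hle : (⨆ j, ⨆ (_ : j ≠ k), NN n σ lam v j) ≤ lperp C.b (NN n σ lam v k) :=
    iSup_le fun j => iSup_le fun hj => w_perp C hj
  exact hle hx2 x hx

theorem NN_internal (C : Ctx n σ lam v) : DirectSum.IsInternal (NN n σ lam v) :=
  DirectSum.isInternal_submodule_of_iSupIndep_of_iSup_eq_top (NN_indep C) (S_top C)

theorem proj_exists [FiniteDimensional ℂ M] (b : PForm M) (S : Submodule ℂ M) (w : M) :
    ∃ a ∈ S, ∀ y ∈ S, b.B a y = b.B w y := by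
  let core : InnerProductSpace.Core ℂ M :=
    { inner := fun x y => b.B x y
      conj_inner_symm := b.symm
      re_inner_nonneg := b.nonneg
      add_left := b.add_left
      smul_left := fun x y r => b.smul_left r x y
      definite := b.definite }
  letI : NormedAddCommGroup M := core.toNormedAddCommGroup
  letI : InnerProductSpace ℂ M := InnerProductSpace.ofCore core.toCore
  obtain ⟨a, ha, z, hz, hw⟩ := S.exists_add_mem_mem_orthogonal w
  refine ⟨a, ha, fun y hy => ?_⟩
  have : b.B z y = 0 := (S.mem_orthogonal' z).1 hz y hy
  rw [hw]
  exact ((b.add_left a z y).trans (by rw [this, add_zero])).symm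

theorem irr_ok [FiniteDimensional ℂ M] (C : Ctx n σ lam v) (kk : expType n lam) (Ns : Submodule ℂ M)
    (hle : Ns ≤ NN n σ lam v kk) (hinv : slInvariant n (Hr n σ) (Er n σ) (Fr n σ) Ns) :
    Ns = ⊥ ∨ Ns = NN n σ lam v kk := by
  obtain ⟨a, ha, hB⟩ := proj_exists C.b Ns (wVec n σ lam v kk.1)
  have hw := w_hw C kk
  have hwk : Kil n σ (wVec n σ lam v kk.1) := hw.2
  have hak : Kil n σ a := by
    intro p q h1 h2 h3
    apply C.b.definite
    have hE := (hinv.2 p q h1 h2 h3 a ha).1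
    rw [C.aEr p q h1 h2 h3, hB _ (hinv.2 p q h1 h2 h3 _ hE).2, ← C.aEr p q h1 h2 h3, hwk p q h1 h2 h3,
      C.b.zero_left]
  have hy2 := slGen_le_nM (res n σ) hw (hle ha)
  obtain ⟨y, hy, c, hc, hyc⟩ := Submodule.mem_sup.1 hy2
  obtain ⟨α, rfl⟩ := Submodule.mem_span_singleton.1 hy
  have hac : c = 0 := by
    apply C.b.definite
    have e : c = a - α • wVec n σ lam v kk.1 := by rw [← hyc]; abel
    conv_lhs => arg 1; rw [e]
    rw [C.b.sub_left, C.b.smul_left, C.kil_nM hak hc, C.kil_nM hwk hc]; simp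
  rw [hac, add_zero] at hyc
  by_cases hα : α = 0
  · left
    rw [hα, zero_smul] at hyc
    have h1 : NN n σ lam v kk ≤ lperp C.b Ns := by
      refine slGen_min (lperp_inv C hinv) ?_
      intro y hy
      rw [← hB y hy, ← hyc, C.b.zero_left]
    rw [Submodule.eq_bot_iff]
    intro x hx
    exact C.b.definite x (h1 (hle hx) x hx)
  · right
    refine le_antisymm hle (slGen_min hinv ?_)
    rw [← hyc] at ha
    exact (Submodule.smul_mem_iff Ns hα).1 ha

end PartH
end Paper

open Paper in
/-- Theorem 4.4 and Corollary 4.5: for the restriction `V(λ)_Φ`, the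
nilpotency profile of the `φ`-operators on the generating highest weight vector is
constant: `J_1^{λ_0} = λ_1 + 1` and `J_k^{λ_0}(i_1, …, i_{k-1}) = λ_k + 1` for all
`2 ≤ k ≤ n+1` and all admissible `0 ≤ i_h ≤ λ_h`; consequently `V(λ)_Φ` decomposes as an
`sl(n+1)`-module as `⊕_{0 ≤ k_l ≤ λ_l} V(λ_0 + ∑_{l=1}^{n} (k_l - k_{l+1}) ω_l)`, the
summand of index `k` being generated by the nonzero highest weight vector
`φ_{n+1}^{k_{n+1}}(⋯(φ_1^{k_1}(v_λ))⋯)` of weight `λ_0 + ∑ (k_l - k_{l+1}) ω_l`. -/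
theorem stmt_19 (n : ℕ) (M : Type) [AddCommGroup M] [Module ℂ M] [FiniteDimensional ℂ M]
    (σ : SLRep (n + 1) M) (lam : ℕ → ℕ) (v : M) (hv0 : v ≠ 0)
    (hv : IsHWvec (n + 1) σ.H σ.E (fun i => (lam i : ℤ)) v)
    (hgen : slGen (n + 1) σ.H σ.E σ.F v = ⊤)
    (hirr : ∀ Ns : Submodule ℂ M, slInvariant (n + 1) σ.H σ.E σ.F Ns → Ns = ⊥ ∨ Ns = ⊤) :
    (∀ k iv, 1 ≤ k → k ≤ n + 1 → (∀ h, 1 ≤ h → h ≤ k - 1 → iv h ≤ lam h) →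
      Jmin (Fr n σ) (Pr n σ) (lam0 lam) v k iv (lam k + 1)) ∧
    DirectSum.IsInternal (fun kk : expType n lam =>
      slGen n (Hr n σ) (Er n σ) (Fr n σ) (wVec n σ lam v kk.1)) ∧
    (∀ kk : expType n lam,
      wVec n σ lam v kk.1 ≠ 0 ∧
      IsHWvec n (Hr n σ) (Er n σ) (nuW n lam kk.1) (wVec n σ lam v kk.1) ∧
      (∀ Ns : Submodule ℂ M, Ns ≤ slGen n (Hr n σ) (Er n σ) (Fr n σ) (wVec n σ lam v kk.1) →
        slInvariant n (Hr n σ) (Er n σ) (Fr n σ) Ns →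
        Ns = ⊥ ∨ Ns = slGen n (Hr n σ) (Er n σ) (Fr n σ) (wVec n σ lam v kk.1))) := by
  obtain ⟨C⟩ := ctx_exists n σ lam v hv0 hv hgen hirr
  refine ⟨fun k iv h1 h2 h => jmin_ok C k iv h1 h2 h, NN_internal C, fun kk =>
    ⟨phi_ne C _ (eL_box kk), w_hw C kk, fun Ns h1 h2 => irr_ok C kk Ns h1 h2⟩⟩
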